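/- arXiv:1607.07069 — 2 statements merged into one kernel-verified Lean document; each statement's English description precedes it below -/
import Mathlib

section
/- Let ω: ℕ → ℝ be any function with ω(n) → ∞ as n → ∞. If p = p(n) satisfies p ≥ (log n + ω(n))/n, then w.h.p. the random graph G(n,p) is connected; and if p ≤ (log n − ω(n))/n, then w.h.p. G(n,p) is disconnected. -/
open MeasureTheory Filter Finset Matrix

noncomputable section

/-- Bernoulli measure on `Bool` with success probability `p` (clamped to `[0,1]`). -/
def bernoulliBool (p : ℝ) : Measure Bool :=
  ENNReal.ofReal (max 0 (min p 1)) • Measure.dirac true +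
    ENNReal.ofReal (1 - max 0 (min p 1)) • Measure.dirac false

instance (p : ℝ) : IsFiniteMeasure (bernoulliBool p) := by
  constructor
  simp only [bernoulliBool, Measure.add_apply, Measure.smul_apply, smul_eq_mul,
    measure_univ, mul_one]
  exact ENNReal.add_lt_top.mpr ⟨ENNReal.ofReal_lt_top, ENNReal.ofReal_lt_top⟩

/-- Index type for potential `d`-dimensional faces on vertex set `Fin n`:
the `(d+1)`-element subsets. -/
abbrev FaceIdx (n d : ℕ) : Type := {s : Finset (Fin n) // s.card = d + 1}

/-- The distribution of the random `d`-complex `Y_d(n,p)`: each potential `d`-face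
gets an independent Bernoulli(`p`) coin. (For `d = 1` this is the Erdős–Rényi model
`G(n,p)`.) -/
def YMeasure (n d : ℕ) (p : ℝ) : Measure (FaceIdx n d → Bool) :=
  Measure.pi fun _ => bernoulliBool p

/-- The random `d`-complex: all faces of dimension `≤ d - 1` (i.e. all subsets of
cardinality `≤ d`, including `∅`, so that degree-0 homology below is reduced
homology), together with the chosen `d`-faces. -/
def Ycomplex (n d : ℕ) (ω : FaceIdx n d → Bool) : Finset (Finset (Fin n)) :=
  Finset.univ.filter fun s => s.card ≤ d ∨ ∃ h : s.card = d + 1, ω ⟨s, h⟩ = true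

/-- The Erdős–Rényi random graph associated to a configuration of edge coins. -/
def graphOf (n : ℕ) (ω : FaceIdx n 1 → Bool) : SimpleGraph (Fin n) where
  Adj i j := i ≠ j ∧ ∃ e : FaceIdx n 1, ω e = true ∧ i ∈ e.1 ∧ j ∈ e.1
  symm := ⟨fun i j ⟨hne, e, he, hi, hj⟩ => ⟨hne.symm, e, he, hj, hi⟩⟩
  loopless := ⟨fun i ⟨hne, _⟩ => hne rfl⟩

instance (n : ℕ) (ω : FaceIdx n 1 → Bool) : DecidableRel (graphOf n ω).Adj :=
  fun i j =>
    inferInstanceAs (Decidable (i ≠ j ∧ ∃ e : FaceIdx n 1, ω e = true ∧ i ∈ e.1 ∧ j ∈ e.1))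

/-- The clique complex of the graph determined by the edge coins `ω`:
faces are vertex sets of complete subgraphs (including `∅` and singletons). -/
def cliqueComplex (n : ℕ) (ω : FaceIdx n 1 → Bool) : Finset (Finset (Fin n)) :=
  Finset.univ.filter fun s => ∀ i ∈ s, ∀ j ∈ s, i ≠ j → (graphOf n ω).Adj i j

/-- The group of simplicial `G`-chains of a complex `K`, in cardinality `c`
(i.e. dimension `c - 1`): functions on the faces of `K` of cardinality `c`. -/
abbrev Chains {V : Type} [Fintype V] [DecidableEq V]
    (K : Finset (Finset V)) (c : ℕ) (G : Type) : Type :=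
  {s : Finset V // s ∈ K ∧ s.card = c} → G

/-- The simplicial boundary map, from chains of cardinality `c+1` to chains of
cardinality `c`, with the usual alternating signs coming from the linear order
on the vertices. -/
def chainBoundary {V : Type} [Fintype V] [DecidableEq V] [LinearOrder V]
    (K : Finset (Finset V)) (c : ℕ) {G : Type} [AddCommGroup G]
    (f : Chains K (c + 1) G) : Chains K c G :=
  fun τ => ∑ v : V,
    if h : v ∉ τ.1 ∧ insert v τ.1 ∈ K then
      ((-1 : ℤ) ^ (τ.1.filter (fun u => u < v)).card) •
        f ⟨insert v τ.1, h.2, by rw [Finset.card_insert_of_notMem h.1, τ.2.2]⟩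
    else 0

/-- Vanishing of the simplicial homology of `K` with coefficients in `G` in
degree `i` (faces of cardinality `i+1`): every cycle is a boundary.
If `∅ ∈ K` this is reduced homology (the boundary map to cardinality-0 chains
is the augmentation); in degrees `i ≥ 1` reduced and unreduced homology agree. -/
def HomologyZero {V : Type} [Fintype V] [DecidableEq V] [LinearOrder V]
    (K : Finset (Finset V)) (i : ℕ) (G : Type) [AddCommGroup G] : Prop :=
  ∀ f : Chains K (i + 1) G, chainBoundary K i f = 0 →
    ∃ g : Chains K (i + 2) G, chainBoundary K (i + 1) g = f

/-- Vanishing of top-dimensional homology `H_d(K,G)`, i.e. the kernel of the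
`d`-th boundary map is zero. -/
def TopHomologyZero {V : Type} [Fintype V] [DecidableEq V] [LinearOrder V]
    (K : Finset (Finset V)) (d : ℕ) (G : Type) [AddCommGroup G] : Prop :=
  ∀ f : Chains K (d + 1) G, chainBoundary K d f = 0 → f = 0

/-- The boundary map on real coefficients, as a linear map. -/
def chainBoundaryLin {V : Type} [Fintype V] [DecidableEq V] [LinearOrder V]
    (K : Finset (Finset V)) (c : ℕ) : Chains K (c + 1) ℝ →ₗ[ℝ] Chains K c ℝ where
  toFun := chainBoundary K c
  map_add' f g := by
    funext τ
    simp only [chainBoundary, Pi.add_apply]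
    rw [← Finset.sum_add_distrib]
    refine Finset.sum_congr rfl fun v _ => ?_
    split
    · simp [smul_add]
    · simp
  map_smul' r f := by
    funext τ
    simp only [chainBoundary, Pi.smul_apply, RingHom.id_apply]
    rw [Finset.smul_sum]
    refine Finset.sum_congr rfl fun v _ => ?_
    split
    · exact smul_comm _ _ _
    · simp

/-- The `k`-th Betti number of `K`: the dimension of the `k`-th real simplicial
homology, i.e. of (kernel of `∂_k`) / (image of `∂_{k+1}`). -/
def bettiNumber {V : Type} [Fintype V] [DecidableEq V] [LinearOrder V]
    (K : Finset (Finset V)) (k : ℕ) : ℕ :=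
  Module.finrank ℝ
    (↥(LinearMap.ker (chainBoundaryLin K k)) ⧸
      (LinearMap.range (chainBoundaryLin K (k + 1))).comap
        (LinearMap.ker (chainBoundaryLin K k)).subtype)

/-- The link of a face `σ` in the complex `K`. -/
def linkSet {V : Type} [Fintype V] [DecidableEq V]
    (K : Finset (Finset V)) (σ : Finset V) : Finset (Finset V) :=
  Finset.univ.filter fun τ => τ ∩ σ = ∅ ∧ τ ∪ σ ∈ K

/-- The graph underlying the link of a face `σ`: its vertices are the vertices
of the link, joined when they span an edge of the link. -/
def linkGraph {V : Type} [Fintype V] [DecidableEq V]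
    (K : Finset (Finset V)) (σ : Finset V) :
    SimpleGraph {v : V // {v} ∈ linkSet K σ} where
  Adj a b := a ≠ b ∧ ({a.1, b.1} : Finset V) ∈ linkSet K σ
  symm := ⟨fun a b ⟨hab, h⟩ => ⟨hab.symm, by rwa [Finset.pair_comm]⟩⟩
  loopless := ⟨fun a ⟨hab, _⟩ => hab rfl⟩

instance {V : Type} [Fintype V] [DecidableEq V] (K : Finset (Finset V)) (σ : Finset V) :
    DecidableRel (linkGraph K σ).Adj :=
  fun a b => inferInstanceAs (Decidable (a ≠ b ∧ ({a.1, b.1} : Finset V) ∈ linkSet K σ))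

/-- The normalized Laplacian `I - D^{-1/2} A D^{-1/2}` of a finite graph. -/
def normalizedLaplacian {W : Type} [Fintype W] [DecidableEq W]
    (H : SimpleGraph W) [DecidableRel H.Adj] : Matrix W W ℝ :=
  Matrix.of fun a b =>
    (if a = b then (1 : ℝ) else 0) -
      (if H.Adj a b then 1 / Real.sqrt ((H.degree a : ℝ) * (H.degree b : ℝ)) else 0)

/-- An elementary `d`-collapse step: remove a free `(d-1)`-face `σ` together with
the unique `d`-face `τ` containing it. -/
def CollapseStep {V : Type} [DecidableEq V] (d : ℕ) (K K' : Finset (Finset V)) : Prop :=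
  ∃ σ τ : Finset V, σ ∈ K ∧ τ ∈ K ∧ τ.card = d + 1 ∧ σ ⊆ τ ∧ σ.card = d ∧
    (∀ ρ ∈ K, σ ⊆ ρ → ρ.card = d + 1 → ρ = τ) ∧ K' = K \ {σ, τ}

/-- `K` is `d`-collapsible if some finite sequence of elementary collapses reduces it
to a complex of dimension at most `d-1`. -/
def IsDCollapsible {V : Type} [DecidableEq V] (d : ℕ) (K : Finset (Finset V)) : Prop :=
  ∃ K' : Finset (Finset V),
    Relation.ReflTransGen (CollapseStep d) K K' ∧ ∀ s ∈ K', s.card ≤ d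

/-- The geometric realization of a complex on vertex set `Fin n`, inside `ℝ^n`:
the union over the faces of the convex hulls of the corresponding standard
basis vectors. -/
def geomReal (n : ℕ) (K : Finset (Finset (Fin n))) : Set (Fin n → ℝ) :=
  ⋃ σ ∈ K, convexHull ℝ ((fun i => (Pi.single i 1 : Fin n → ℝ)) '' ↑σ)

/-- The boundary of the simplex on the vertex set `τ`, as a chain of cardinality
`c` (to be used with `τ.card = c + 1`): the alternating sum of the `c`-element
subsets of `τ`. -/
def simplexBoundaryChain {V : Type} [Fintype V] [DecidableEq V] [LinearOrder V]
    (K : Finset (Finset V)) (c : ℕ) (τ : Finset V) : Chains K c ℝ :=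
  fun σ => ∑ v ∈ τ,
    if σ.1 = τ.erase v then ((-1 : ℝ) ^ (τ.filter (fun u => u < v)).card) else 0

/-- Index type for the multiparameter model: all potential faces of dimension `≥ 1`. -/
abbrev MultiIdx (n : ℕ) : Type := {s : Finset (Fin n) // 2 ≤ s.card}

/-- The distribution of the multiparameter random complex `X(n; p₁, p₂, …)`:
a potential face of cardinality `i+1` gets an independent Bernoulli(`p i`) coin. -/
def multiMeasure (n : ℕ) (p : ℕ → ℝ) : Measure (MultiIdx n → Bool) :=
  Measure.pi fun t => bernoulliBool (p (t.1.card - 1))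

/-- The multiparameter random complex: a set `s` is a face iff every subset of `s`
of dimension `≥ 1` has its coin turned on (this is exactly the
inductive-by-dimension construction: a face is present iff its coin is on and all
of its boundary faces are present). -/
def multiComplex (n : ℕ) (ω : MultiIdx n → Bool) : Finset (Finset (Fin n)) :=
  Finset.univ.filter fun s => ∀ t : MultiIdx n, t.1 ⊆ s → ω t = true

/-- The Vietoris–Rips complex of the points `pts` at scale `r`. -/
def VRcomplex (n d : ℕ) (pts : Fin n → EuclideanSpace ℝ (Fin d)) (r : ℝ) :
    Finset (Finset (Fin n)) :=
  Finset.univ.filter fun s => ∀ i ∈ s, ∀ j ∈ s, dist (pts i) (pts j) ≤ r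

end


noncomputable section

/-- clamped failure probability -/
def qq (p : ℝ) : ℝ := 1 - max 0 (min p 1)

lemma qq_nonneg (p : ℝ) : 0 ≤ qq p := by
  unfold qq
  have : max 0 (min p 1) ≤ 1 := max_le zero_le_one (min_le_right _ _)
  linarith

lemma qq_le_one (p : ℝ) : qq p ≤ 1 := by
  unfold qq
  have : 0 ≤ max 0 (min p 1) := le_max_left _ _
  linarith

instance bern_prob (p : ℝ) : IsProbabilityMeasure (bernoulliBool p) := by
  constructor
  simp only [bernoulliBool, Measure.add_apply, Measure.smul_apply, smul_eq_mul,
    measure_univ, mul_one]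
  have h : 0 ≤ 1 - max 0 (min p 1) := qq_nonneg p
  rw [← ENNReal.ofReal_add (le_max_left _ _) h]
  simp

instance Y_prob (n d : ℕ) (p : ℝ) : IsProbabilityMeasure (YMeasure n d p) := by
  unfold YMeasure; infer_instance

lemma meas_all {n d : ℕ} (s : Set (FaceIdx n d → Bool)) : MeasurableSet s :=
  (Set.toFinite s).measurableSet

lemma Y_false (n : ℕ) (p : ℝ) (F : Finset (FaceIdx n 1)) :
    (YMeasure n 1 p).real {ω | ∀ e ∈ F, ω e = false} = qq p ^ F.card := by
  have h : {ω : FaceIdx n 1 → Bool | ∀ e ∈ F, ω e = false} =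
      Set.pi Set.univ (fun e => if e ∈ F then {false} else Set.univ) := by
    ext ω
    simp only [Set.mem_ofPred_eq, Set.mem_pi, Set.mem_univ, true_implies]
    refine forall_congr' fun e => ?_
    split_ifs with he <;> simp [he]
  have hb : bernoulliBool p {false} = ENNReal.ofReal (qq p) := by
    simp [bernoulliBool, qq]
  rw [Measure.real, h, YMeasure, Measure.pi_pi, ENNReal.toReal_prod]
  have : ∀ e : FaceIdx n 1, (bernoulliBool p (if e ∈ F then {false} else Set.univ)).toReal
      = if e ∈ F then qq p else 1 := by
    intro e
    split_ifs
    · rw [hb, ENNReal.toReal_ofReal (qq_nonneg p)]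
    · rw [measure_univ, ENNReal.toReal_one]
  simp only [this]
  rw [Finset.prod_ite_mem]
  simp

/-- edges crossing the cut `S` -/
def cut (n : ℕ) (S : Finset (Fin n)) : Finset (FaceIdx n 1) :=
  Finset.univ.filter fun e => ∃ a ∈ S, ∃ b ∉ S, e.1 = {a, b}

lemma pair_inj {n : ℕ} {S : Finset (Fin n)} {a b a' b' : Fin n} (ha : a ∈ S) (hb : b ∉ S)
    (ha' : a' ∈ S) (hb' : b' ∉ S) (h : ({a, b} : Finset (Fin n)) = {a', b'}) :
    a = a' ∧ b = b' := by
  have h1 : a ∈ ({a', b'} : Finset (Fin n)) := by rw [← h]; simp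
  have h2 : b ∈ ({a', b'} : Finset (Fin n)) := by rw [← h]; simp
  simp only [Finset.mem_insert, Finset.mem_singleton] at h1 h2
  constructor
  · rcases h1 with h1 | h1
    · exact h1
    · exact absurd (h1 ▸ ha) hb'
  · rcases h2 with h2 | h2
    · exact absurd (h2 ▸ ha') hb
    · exact h2

lemma card_cut (n : ℕ) (S : Finset (Fin n)) : (cut n S).card = S.card * (n - S.card) := by
  have h : (S ×ˢ Sᶜ).card = (cut n S).card := by
    refine Finset.card_bij (fun x hx => ⟨{x.1, x.2}, ?_⟩) ?_ ?_ ?_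
    · simp only [Finset.mem_product, Finset.mem_compl] at hx
      rw [Finset.card_pair]
      rintro h
      exact hx.2 (h ▸ hx.1)
    · intro x hx
      simp only [Finset.mem_product, Finset.mem_compl] at hx
      simp only [cut, Finset.mem_filter, Finset.mem_univ, true_and]
      exact ⟨_, hx.1, _, hx.2, rfl⟩
    · intro x hx y hy h
      simp only [Finset.mem_product, Finset.mem_compl] at hx hy
      have := pair_inj hx.1 hx.2 hy.1 hy.2 (congrArg Subtype.val h)
      exact Prod.ext this.1 this.2
    · intro e he
      simp only [cut, Finset.mem_filter, Finset.mem_univ, true_and] at he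
      obtain ⟨a, ha, b, hb, h⟩ := he
      exact ⟨(a, b), by simp [ha, hb], Subtype.ext h.symm⟩
  rw [← h, Finset.card_product, Finset.card_compl, Fintype.card_fin]

lemma exists_cut {n : ℕ} (hn : 0 < n) (ω : FaceIdx n 1 → Bool) (h : ¬ (graphOf n ω).Connected) :
    ∃ S : Finset (Fin n), 0 < S.card ∧ 2 * S.card ≤ n ∧ ∀ e ∈ cut n S, ω e = false := by
  classical
  have : Nonempty (Fin n) := ⟨⟨0, hn⟩⟩
  have h' : ¬ (graphOf n ω).Preconnected := fun hp => h ⟨hp⟩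
  simp only [SimpleGraph.Preconnected, not_forall] at h'
  obtain ⟨u, v, huv⟩ := h'
  set T : Finset (Fin n) := Finset.univ.filter fun x => (graphOf n ω).Reachable u x with hT
  have hcross : ∀ a ∈ T, ∀ b ∉ T, ∀ e : FaceIdx n 1, e.1 = {a, b} → ω e = false := by
    intro a ha b hb e he
    by_contra hc
    simp only [Bool.not_eq_false] at hc
    simp only [hT, Finset.mem_filter, Finset.mem_univ, true_and] at ha hb
    apply hb
    refine ha.trans (SimpleGraph.Adj.reachable ⟨?_, e, hc, ?_, ?_⟩)
    · rintro rfl; exact hb ha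
    · simp [he]
    · simp [he]
  have hu : u ∈ T := by simp [hT]
  have hv : v ∈ Tᶜ := by simp [hT, huv]
  have hc : T.card + Tᶜ.card = n := by rw [Finset.card_add_card_compl, Fintype.card_fin]
  rcases le_total T.card Tᶜ.card with hle | hle
  · refine ⟨T, Finset.card_pos.mpr ⟨u, hu⟩, by omega, ?_⟩
    intro e he
    simp only [cut, Finset.mem_filter, Finset.mem_univ, true_and] at he
    obtain ⟨a, ha, b, hb, h⟩ := he
    exact hcross a ha b hb e h
  · refine ⟨Tᶜ, Finset.card_pos.mpr ⟨v, hv⟩, by omega, ?_⟩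
    intro e he
    simp only [cut, Finset.mem_filter, Finset.mem_univ, true_and] at he
    obtain ⟨a, ha, b, hb, h⟩ := he
    simp only [Finset.mem_compl, not_not] at ha hb
    exact hcross b hb a ha e (by rw [h, Finset.pair_comm])

lemma term_bound {n k : ℕ} (hk : 0 < k) (hkn : 2 * k ≤ n) {c q : ℝ} (hc : 0 ≤ c) (hq0 : 0 ≤ q)
    (hq : q ≤ Real.exp (-((Real.log n + c) / n))) :
    (n.choose k : ℝ) * q ^ (k * (n - k)) ≤ Real.exp (2 - c / 2) ^ k := by
  have hk0 : (0 : ℝ) < k := by exact_mod_cast hk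
  have hn0 : (0 : ℝ) < n := by exact_mod_cast (by omega : 0 < n)
  have hkn' : 2 * (k : ℝ) ≤ n := by exact_mod_cast hkn
  have hq1 : q ^ (k * (n - k)) ≤ Real.exp (-((Real.log n + c) / n) * (k * (n - k))) := by
    refine (pow_le_pow_left₀ hq0 hq _).trans (le_of_eq ?_)
    rw [← Real.exp_nat_mul, mul_comm]
    push_cast [Nat.cast_sub (by omega : k ≤ n)]
    rfl
  have hch : (n.choose k : ℝ) ≤ Real.exp (k * Real.log n - k * Real.log k + k) := by
    have h1 : (n.choose k : ℝ) ≤ (n : ℝ) ^ k / k.factorial := Nat.choose_le_pow_div k n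
    have h2 : (k : ℝ) ^ k / k.factorial ≤ Real.exp k := Real.pow_div_factorial_le_exp k hk0.le k
    have h3 : (n : ℝ) ^ k = Real.exp (k * Real.log n) := by
      rw [Real.exp_nat_mul, Real.exp_log hn0]
    have h4 : (k : ℝ) ^ k = Real.exp (k * Real.log k) := by
      rw [Real.exp_nat_mul, Real.exp_log hk0]
    have hf : (0 : ℝ) < k.factorial := by exact_mod_cast k.factorial_pos
    rw [Real.exp_add, Real.exp_sub, ← h3, ← h4]
    refine h1.trans ?_
    rw [div_le_iff₀ hf] at h2 ⊢
    rw [div_mul_eq_mul_div, div_mul_eq_mul_div, le_div_iff₀ (by positivity), mul_assoc]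
    gcongr
  have hlog : (k : ℝ) / n * Real.log n ≤ Real.log k + 1 := by
    have h1 : Real.log n = Real.log k + Real.log (n / k) := by
      rw [Real.log_div hn0.ne' hk0.ne']; ring
    have h2 : Real.log ((n : ℝ) / k) ≤ n / k := (Real.log_le_sub_one_of_pos (by positivity)).trans (by linarith)
    have h3 : 0 ≤ Real.log k := Real.log_natCast_nonneg k
    have h4 : (k : ℝ) / n ≤ 1 := by rw [div_le_one hn0]; linarith
    have h5 : (k : ℝ) / n * (n / k) = 1 := by field_simp
    rw [h1, mul_add]
    have h6 := mul_le_mul_of_nonneg_left h2 (by positivity : 0 ≤ (k : ℝ) / n)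
    have h7 := mul_le_mul_of_nonneg_right h4 h3
    linarith
  calc (n.choose k : ℝ) * q ^ (k * (n - k))
      ≤ Real.exp (k * Real.log n - k * Real.log k + k) *
        Real.exp (-((Real.log n + c) / n) * (k * (n - k))) := by gcongr
    _ = Real.exp ((k * Real.log n - k * Real.log k + k) +
        (-((Real.log n + c) / n) * (k * (n - k)))) := (Real.exp_add _ _).symm
    _ ≤ Real.exp (k * (2 - c / 2)) := by
        apply Real.exp_le_exp.mpr
        have e1 : (k * Real.log n - k * Real.log k + k) +
          (-((Real.log n + c) / n) * (k * (n - k))) =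
          k * (1 - Real.log k + k / n * Real.log n - c * (1 - k / n)) := by
          field_simp; ring
        rw [e1]
        apply mul_le_mul_of_nonneg_left _ hk0.le
        have h4 : (k : ℝ) / n ≤ 1 / 2 := by rw [div_le_div_iff₀ hn0 (by norm_num)]; linarith
        nlinarith
    _ = _ := by rw [Real.exp_nat_mul]

lemma disc_bound {n : ℕ} (hn : 0 < n) {c p : ℝ} (hc : 0 ≤ c)
    (hq : qq p ≤ Real.exp (-((Real.log n + c) / n))) (hx : Real.exp (2 - c / 2) < 1) :
    (YMeasure n 1 p).real {ω | ¬ (graphOf n ω).Connected} ≤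
      Real.exp (2 - c / 2) / (1 - Real.exp (2 - c / 2)) := by
  classical
  set x := Real.exp (2 - c / 2) with hxd
  have hx0 : 0 < x := Real.exp_pos _
  set P : Finset (Finset (Fin n)) :=
    Finset.univ.filter fun S => 0 < S.card ∧ 2 * S.card ≤ n with hP
  have h1 : (YMeasure n 1 p).real {ω | ¬ (graphOf n ω).Connected} ≤
      (YMeasure n 1 p).real (⋃ S ∈ P, {ω | ∀ e ∈ cut n S, ω e = false}) := by
    apply measureReal_mono
    · intro ω hω
      obtain ⟨S, h1, h2, h3⟩ := exists_cut hn ω hω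
      simp only [Set.mem_iUnion]
      exact ⟨S, by simp only [hP, Finset.mem_filter, Finset.mem_univ, true_and]; exact ⟨h1, h2⟩, h3⟩
    · exact measure_ne_top _ _
  refine h1.trans ((measureReal_biUnion_finset_le _ _).trans ?_)
  simp only [Y_false, card_cut]
  have h2 : ∑ S ∈ P, qq p ^ (S.card * (n - S.card)) ≤
      ∑ k ∈ (Finset.range (n + 1)).filter (fun k => 0 < k ∧ 2 * k ≤ n),
        (n.choose k : ℝ) * qq p ^ (k * (n - k)) := by
    rw [hP, Finset.sum_filter, Finset.sum_filter]
    have := Finset.sum_powerset_apply_card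
      (fun k => if 0 < k ∧ 2 * k ≤ n then qq p ^ (k * (n - k)) else 0) (x := (Finset.univ : Finset (Fin n)))
    simp only [Finset.powerset_univ, Finset.card_univ, Fintype.card_fin] at this
    rw [this]
    apply le_of_eq
    refine Finset.sum_congr rfl fun k _ => ?_
    split_ifs <;> simp
  refine h2.trans ?_
  have h3 : ∑ k ∈ (Finset.range (n + 1)).filter (fun k => 0 < k ∧ 2 * k ≤ n),
        (n.choose k : ℝ) * qq p ^ (k * (n - k)) ≤
      ∑ k ∈ (Finset.range (n + 1)).filter (fun k => 0 < k ∧ 2 * k ≤ n), x ^ k := by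
    refine Finset.sum_le_sum fun k hk => ?_
    simp only [Finset.mem_filter] at hk
    exact term_bound hk.2.1 hk.2.2 hc (qq_nonneg p) hq
  refine h3.trans ?_
  have h4 : ∑ k ∈ (Finset.range (n + 1)).filter (fun k => 0 < k ∧ 2 * k ≤ n), x ^ k ≤
      ∑ k ∈ Finset.Ico 1 (n + 1), x ^ k := by
    apply Finset.sum_le_sum_of_subset_of_nonneg
    · intro k hk
      simp only [Finset.mem_filter, Finset.mem_range] at hk
      simp only [Finset.mem_Ico]; omega
    · intros; positivity
  refine h4.trans ?_
  have := geom_sum_Ico_le_of_lt_one (m := 1) (n := n + 1) hx0.le hx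
  simpa using this


lemma conn_not_iso {n : ℕ} (hn : 2 ≤ n) (ω : FaceIdx n 1 → Bool) (h : (graphOf n ω).Connected)
    (v : Fin n) : ¬ ∀ e ∈ cut n {v}, ω e = false := by
  intro hv
  have : Nontrivial (Fin n) := Fin.nontrivial_iff_two_le.mpr hn
  obtain ⟨u, hu⟩ := exists_ne v
  obtain ⟨W⟩ := h.preconnected v u
  cases W with
  | nil => exact hu rfl
  | @cons _ x _ hadj _ =>
    obtain ⟨hne, e, he, h1, h2⟩ := hadj
    have hsub : ({v, x} : Finset (Fin n)) ⊆ e.1 := by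
      intro y hy
      simp only [Finset.mem_insert, Finset.mem_singleton] at hy
      rcases hy with rfl | rfl <;> assumption
    have heq : ({v, x} : Finset (Fin n)) = e.1 :=
      Finset.eq_of_subset_of_card_le hsub (by rw [e.2, Finset.card_pair hne])
    have := hv e (by
      simp only [cut, Finset.mem_filter, Finset.mem_univ, true_and]
      exact ⟨v, by simp, x, by simpa using hne.symm, heq.symm⟩)
    rw [this] at he
    exact absurd he (by simp)

lemma card_cut_union {n : ℕ} {u v : Fin n} (huv : u ≠ v) :
    2 * (n - 1) - 1 ≤ (cut n {u} ∪ cut n {v}).card := by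
  classical
  have h1 := Finset.card_union_add_card_inter (cut n {u}) (cut n {v})
  rw [card_cut, card_cut] at h1
  simp only [Finset.card_singleton, one_mul] at h1
  have h2 : (cut n {u} ∩ cut n {v}).card ≤ 1 := by
    rw [Finset.card_le_one]
    have key : ∀ e ∈ cut n {u} ∩ cut n {v}, e.1 = {u, v} := by
      intro e he
      simp only [cut, Finset.mem_inter, Finset.mem_filter, Finset.mem_univ, true_and,
        Finset.mem_singleton, exists_eq_left] at he
      obtain ⟨⟨b, _, hb'⟩, ⟨c, _, hc'⟩⟩ := he
      symm
      apply Finset.eq_of_subset_of_card_le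
      · intro y hy
        simp only [Finset.mem_insert, Finset.mem_singleton] at hy
        rcases hy with rfl | rfl
        · rw [hb']; simp
        · rw [hc']; simp
      · rw [e.2, Finset.card_pair huv]
    intro a ha b hb
    exact Subtype.ext ((key a ha).trans (key b hb).symm)
  omega

lemma conn_bound {n : ℕ} (hn : 2 ≤ n) {p : ℝ} (hq : 0 < qq p) :
    (YMeasure n 1 p).real {ω | (graphOf n ω).Connected} ≤
      1 / (n * qq p ^ (n - 1)) + (1 / qq p - 1) := by
  classical
  set μ := YMeasure n 1 p with hμ
  set q := qq p with hqd
  set m : ℝ := n * q ^ (n - 1) with hm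
  have hn0 : (0 : ℝ) < n := by exact_mod_cast (by omega : 0 < n)
  have hm0 : 0 < m := by positivity
  let A : Fin n → Set (FaceIdx n 1 → Bool) := fun v => {ω | ∀ e ∈ cut n {v}, ω e = false}
  let I : Fin n → (FaceIdx n 1 → Bool) → ℝ := fun v => (A v).indicator 1
  let X : (FaceIdx n 1 → Bool) → ℝ := fun ω => ∑ v, I v ω
  have hint : ∀ f : (FaceIdx n 1 → Bool) → ℝ, Integrable f μ := fun f => Integrable.of_finite
  have hI : ∀ v, ∫ ω, I v ω ∂μ = q ^ (n - 1) := by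
    intro v
    rw [integral_indicator_one (meas_all _)]
    have := Y_false n p (cut n {v})
    rw [card_cut, Finset.card_singleton, one_mul] at this
    exact this
  have hII : ∀ u v, u ≠ v → ∫ ω, I u ω * I v ω ∂μ ≤ q ^ (2 * (n - 1) - 1) := by
    intro u v huv
    have h1 : (fun ω => I u ω * I v ω) =
        ({ω | ∀ e ∈ cut n {u} ∪ cut n {v}, ω e = false} : Set _).indicator 1 := by
      funext ω
      have hs : {ω : FaceIdx n 1 → Bool | ∀ e ∈ cut n {u} ∪ cut n {v}, ω e = false}
          = A u ∩ A v := by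
        ext ω
        simp only [A, Set.mem_inter_iff, Set.mem_ofPred_eq, Finset.mem_union]
        exact ⟨fun h => ⟨fun e he => h e (Or.inl he), fun e he => h e (Or.inr he)⟩,
          fun h e he => he.elim (h.1 e) (h.2 e)⟩
      rw [hs, Set.inter_indicator_one]
      rfl
    rw [h1, integral_indicator_one (meas_all _), Y_false]
    exact pow_le_pow_of_le_one hq.le (qq_le_one p) (card_cut_union huv)
  have hII' : ∀ v, ∫ ω, I v ω * I v ω ∂μ = q ^ (n - 1) := by
    intro v
    rw [← hI v]
    congr 1
    funext ω
    by_cases h : ω ∈ A v <;> simp [I, h]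
  have hX : ∫ ω, X ω ∂μ = m := by
    rw [integral_finsetSum _ (fun _ _ => hint _)]
    simp [hI, hm]
  have hpow : q ^ (2 * (n - 1) - 1) = q ^ (n - 1) * q ^ (n - 1) / q := by
    rw [eq_div_iff hq.ne', ← pow_succ, ← pow_add]
    congr 1
    omega
  have hXX : ∫ ω, X ω * X ω ∂μ ≤ m + m ^ 2 / q := by
    have h1 : ∀ ω, X ω * X ω = ∑ u, ∑ v, I u ω * I v ω := fun ω => Finset.sum_mul_sum _ _ _ _
    simp only [h1]
    rw [integral_finsetSum _ (fun _ _ => hint _)]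
    have h2 : ∀ u, ∫ ω, ∑ v, I u ω * I v ω ∂μ ≤
        q ^ (n - 1) + n * (q ^ (n - 1) * q ^ (n - 1) / q) := by
      intro u
      rw [integral_finsetSum _ (fun _ _ => hint _)]
      calc ∑ v, ∫ ω, I u ω * I v ω ∂μ
          ≤ ∑ v, ((if u = v then q ^ (n - 1) else 0) + q ^ (n - 1) * q ^ (n - 1) / q) := by
            refine Finset.sum_le_sum fun v _ => ?_
            split_ifs with h
            · subst h
              rw [hII']
              have : 0 ≤ q ^ (n - 1) * q ^ (n - 1) / q := by positivity
              linarith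
            · rw [zero_add, ← hpow]; exact hII u v h
        _ = _ := by simp [Finset.sum_add_distrib]
    refine (Finset.sum_le_sum fun u _ => h2 u).trans (le_of_eq ?_)
    simp only [Finset.sum_const, Finset.card_univ, Fintype.card_fin, nsmul_eq_mul, hm]
    ring
  have hle : m ^ 2 * μ.real {ω | (graphOf n ω).Connected} ≤ m + m ^ 2 / q - m ^ 2 := by
    calc m ^ 2 * μ.real {ω | (graphOf n ω).Connected}
        = ∫ ω, m ^ 2 * ({ω | (graphOf n ω).Connected} : Set _).indicator 1 ω ∂μ := by
          rw [integral_const_mul, integral_indicator_one (meas_all _)]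
      _ ≤ ∫ ω, (X ω * X ω + (m ^ 2 - 2 * m * X ω)) ∂μ := by
          refine integral_mono (hint _) (hint _) fun ω => ?_
          by_cases h : (graphOf n ω).Connected
          · have hz : X ω = 0 := by
              refine Finset.sum_eq_zero fun v _ => ?_
              have hnm : ω ∉ A v := conn_not_iso hn ω h v
              exact Set.indicator_of_notMem hnm _
            simp [h, hz]
          · simp only [Set.indicator, Set.mem_ofPred_eq, h, if_false, mul_zero]
            nlinarith [sq_nonneg (X ω - m)]
      _ = ∫ ω, X ω * X ω ∂μ + (m ^ 2 - 2 * m * m) := by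
          rw [integral_add (hint _) (hint _), integral_sub (hint _) (hint _), integral_const_mul, hX]
          simp
      _ ≤ _ := by linarith
  have e : m + m ^ 2 / q - m ^ 2 = m ^ 2 * (1 / m + (1 / q - 1)) := by field_simp; ring
  rw [e] at hle
  exact le_of_mul_le_mul_left hle (by positivity)

lemma conn_bound' {n : ℕ} (hn : 2 ≤ n) {c p : ℝ} (hc0 : 0 ≤ c) (hc : c ≤ Real.log n)
    (hp : p ≤ (Real.log n - c) / n) (h1 : Real.log n / n ≤ 1 / 2)
    (h2 : Real.log n ^ 2 / n ≤ 1 / 2) :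
    (YMeasure n 1 p).real {ω | (graphOf n ω).Connected} ≤
      Real.exp (1 - c) + 2 * (Real.log n / n) := by
  have hn0 : (0 : ℝ) < n := by exact_mod_cast (by omega : 0 < n)
  set r := (Real.log n - c) / n with hr
  have hr0 : 0 ≤ r := div_nonneg (by linarith) hn0.le
  have hrl : r ≤ Real.log n / n := by rw [hr]; gcongr; linarith
  have hq : 1 - r ≤ qq p := by
    unfold qq
    have : max 0 (min p 1) ≤ r := max_le hr0 ((min_le_left _ _).trans hp)
    linarith
  have hq0 : 0 < qq p := by linarith
  refine (conn_bound hn hq0).trans ?_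
  have hr1 : 0 < 1 - r := by linarith
  have hexp : Real.exp (-(r * (1 + 2 * r))) ≤ 1 - r := by
    have h3 : Real.exp (-(r / (1 - r))) ≤ 1 - r := by
      rw [Real.exp_neg, inv_le_comm₀ (Real.exp_pos _) hr1]
      have := Real.add_one_le_exp (r / (1 - r))
      have e : (1 - r)⁻¹ = r / (1 - r) + 1 := by field_simp; ring
      linarith
    refine le_trans (Real.exp_le_exp.mpr ?_) h3
    rw [neg_le_neg_iff, div_le_iff₀ hr1]
    nlinarith [mul_nonneg hr0 hr0]
  have hm : Real.exp (c - 1) ≤ n * qq p ^ (n - 1) := by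
    calc Real.exp (c - 1) ≤ Real.exp (Real.log n + n * (-(r * (1 + 2 * r)))) := by
          apply Real.exp_le_exp.mpr
          have e : n * (-(r * (1 + 2 * r))) = -(Real.log n - c) - 2 * (n * r ^ 2) := by
            have : n * r = Real.log n - c := by rw [hr]; field_simp
            rw [← this]; ring
          have : n * r ^ 2 ≤ n * (Real.log n / n) ^ 2 := by gcongr
          have e2 : n * (Real.log n / n) ^ 2 = Real.log n ^ 2 / n := by field_simp
          linarith
      _ = n * Real.exp (-(r * (1 + 2 * r))) ^ n := by
          rw [Real.exp_add, Real.exp_log hn0, Real.exp_nat_mul]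
      _ ≤ n * qq p ^ n := by
          gcongr
          exact hexp.trans hq
      _ ≤ n * qq p ^ (n - 1) := by
          gcongr ?_ * ?_
          exact pow_le_pow_of_le_one hq0.le (qq_le_one p) (Nat.sub_le _ _)
  have a1 : 1 / (n * qq p ^ (n - 1)) ≤ Real.exp (1 - c) := by
    rw [show (1 - c) = -(c - 1) by ring, Real.exp_neg, ← one_div]
    exact one_div_le_one_div_of_le (Real.exp_pos _) hm
  have a2 : 1 / qq p - 1 ≤ 2 * r := by
    have : 1 / qq p ≤ 1 / (1 - r) := one_div_le_one_div_of_le hr1 hq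
    have : 1 / (1 - r) ≤ 1 + 2 * r := by
      rw [div_le_iff₀ hr1]; nlinarith
    linarith
  linarith

lemma whp {s : ∀ n : ℕ, Set (FaceIdx n 1 → Bool)} {p : ℕ → ℝ}
    (h : Tendsto (fun n => (YMeasure n 1 (p n)).real (s n)ᶜ) atTop (nhds 0)) :
    Tendsto (fun n => YMeasure n 1 (p n) (s n)) atTop (nhds (1 : ENNReal)) := by
  have h1 : Tendsto (fun n => ENNReal.ofReal (1 - (YMeasure n 1 (p n)).real (s n)ᶜ)) atTop
      (nhds (ENNReal.ofReal (1 - 0))) :=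
    ENNReal.tendsto_ofReal (tendsto_const_nhds.sub h)
  simp only [sub_zero, ENNReal.ofReal_one] at h1
  refine h1.congr fun n => ?_
  rw [probReal_compl_eq_one_sub (meas_all _), sub_sub_cancel]
  exact ofReal_measureReal

end

noncomputable section
/-- **Erdős–Rényi theorem (sharp threshold for connectivity).**
If `p ≥ (log n + ω(n))/n` then w.h.p. `G(n,p)` is connected, and if
`p ≤ (log n − ω(n))/n` then w.h.p. `G(n,p)` is disconnected. -/
theorem erdos_renyi_connectivity_threshold
    (w : ℕ → ℝ) (hw : Tendsto w atTop atTop) (p : ℕ → ℝ) :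
    ((∀ n : ℕ, (Real.log n + w n) / n ≤ p n) →
      Tendsto (fun n : ℕ => YMeasure n 1 (p n) {ω | (graphOf n ω).Connected})
        atTop (nhds (1 : ENNReal))) ∧
    ((∀ n : ℕ, p n ≤ (Real.log n - w n) / n) →
      Tendsto (fun n : ℕ => YMeasure n 1 (p n) {ω | ¬ (graphOf n ω).Connected})
        atTop (nhds (1 : ENNReal))) := by
  have hlogN : Tendsto (fun n : ℕ => Real.log n) atTop atTop :=
    Real.tendsto_log_atTop.comp tendsto_natCast_atTop_atTop
  constructor
  · intro hp
    apply whp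
    have hx : Tendsto (fun n => Real.exp (2 - w n / 2)) atTop (nhds 0) := by
      apply Real.tendsto_exp_atBot.comp
      have : Tendsto (fun n => w n / 2) atTop atTop := hw.atTop_div_const (by norm_num)
      exact tendsto_atBot_add_const_left _ 2 (tendsto_neg_atTop_atBot.comp this)
    have hb : Tendsto (fun n => Real.exp (2 - w n / 2) / (1 - Real.exp (2 - w n / 2))) atTop
        (nhds 0) := by
      have := hx.div (tendsto_const_nhds.sub hx) (by norm_num : (1 : ℝ) - 0 ≠ 0)
      rw [sub_zero, zero_div] at this
      exact this
    refine squeeze_zero' (Eventually.of_forall fun n => measureReal_nonneg) ?_ hb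
    filter_upwards [hx.eventually_lt_const (zero_lt_one), eventually_gt_atTop 0,
      hw.eventually_ge_atTop 0] with n h1 h2 h3
    refine disc_bound h2 h3 ?_ h1
    have hn0 : (0 : ℝ) < n := by exact_mod_cast h2
    set t := (Real.log n + w n) / n with ht
    have ht0 : 0 ≤ t := div_nonneg (add_nonneg (Real.log_natCast_nonneg n) h3) hn0.le
    unfold qq
    rcases le_total (p n) 1 with h | h
    · have : p n ≤ max 0 (min (p n) 1) := by rw [min_eq_left h]; exact le_max_right _ _
      have h5 := Real.add_one_le_exp (-t)
      have h6 : t ≤ p n := hp n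
      linarith
    · rw [min_eq_right h]
      simp only [zero_le_one, sup_of_le_right, sub_self]
      exact (Real.exp_pos _).le
  · intro hp
    apply whp
    have hcpl : ∀ n : ℕ, {ω : FaceIdx n 1 → Bool | ¬ (graphOf n ω).Connected}ᶜ =
        {ω | (graphOf n ω).Connected} := by
      intro n; ext ω; simp
    simp only [hcpl]
    set c : ℕ → ℝ := fun n => min (w n) (Real.log n) with hc
    have hcT : Tendsto c atTop atTop := by
      rw [tendsto_atTop]
      intro b
      filter_upwards [hw.eventually_ge_atTop b, hlogN.eventually_ge_atTop b] with n h1 h2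
      exact le_min h1 h2
    have hx : Tendsto (fun n => Real.exp (1 - c n)) atTop (nhds 0) := by
      apply Real.tendsto_exp_atBot.comp
      exact tendsto_atBot_add_const_left _ 1 (tendsto_neg_atTop_atBot.comp hcT)
    have hl (k : ℕ) : Tendsto (fun n : ℕ => Real.log n ^ k / n) atTop (nhds 0) := by
      have := (Real.isLittleO_pow_log_id_atTop (n := k)).tendsto_div_nhds_zero
      exact this.comp tendsto_natCast_atTop_atTop
    have hl1 : Tendsto (fun n : ℕ => Real.log n / n) atTop (nhds 0) := by
      simpa using hl 1
    have hb : Tendsto (fun n : ℕ => Real.exp (1 - c n) + 2 * (Real.log n / n)) atTop (nhds 0) := by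
      simpa using hx.add (hl1.const_mul 2)
    refine squeeze_zero' (Eventually.of_forall fun n => measureReal_nonneg) ?_ hb
    filter_upwards [hcT.eventually_ge_atTop 0, eventually_ge_atTop 2,
      hl1.eventually_le_const (by norm_num : (0 : ℝ) < 1 / 2),
      (hl 2).eventually_le_const (by norm_num : (0 : ℝ) < 1 / 2)] with n h1 h2 h3 h4
    refine conn_bound' h2 h1 (min_le_right _ _) ((hp n).trans ?_) h3 h4
    have : c n ≤ w n := min_le_left _ _
    gcongr
end
end

section
/- Fix c > 0 and let p = c/n. If c ≥ 1, then the probability that G(n,p) contains at least one cycle tends to 1 as n → ∞. If c < 1, then the probability that G(n,p) contains no cycle (i.e., is a forest) tends to √(1−c)·exp(c/2 + c²/4) as n → ∞. -/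
open MeasureTheory Filter Finset Matrix

noncomputable section

section Prob
variable {ι : Type} [Fintype ι] [DecidableEq ι]

def wt (p : ℝ) (s : Finset ι) : ℝ := ∏ i, if i ∈ s then p else 1 - p

def Ex (p : ℝ) (g : Finset ι → ℝ) : ℝ := ∑ s, wt p s * g s

lemma wt_nonneg {p : ℝ} (h0 : 0 ≤ p) (h1 : p ≤ 1) (s : Finset ι) : 0 ≤ wt p s := by
  unfold wt
  refine Finset.prod_nonneg fun i _ => ?_
  split_ifs <;> linarith

lemma Ex_mono {p : ℝ} (h0 : 0 ≤ p) (h1 : p ≤ 1) {f g : Finset ι → ℝ} (h : ∀ s, f s ≤ g s) :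
    Ex p f ≤ Ex p g :=
  Finset.sum_le_sum fun s _ => mul_le_mul_of_nonneg_left (h s) (wt_nonneg h0 h1 s)

lemma Ex_sub (p : ℝ) (f g : Finset ι → ℝ) : Ex p (fun s => f s - g s) = Ex p f - Ex p g := by
  simp [Ex, mul_sub, Finset.sum_sub_distrib]

lemma Ex_sum {κ : Type*} (p : ℝ) (F : Finset κ) (f : κ → Finset ι → ℝ) :
    Ex p (fun s => ∑ k ∈ F, f k s) = ∑ k ∈ F, Ex p (f k) := by
  simp only [Ex, Finset.mul_sum]
  rw [Finset.sum_comm]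

lemma sum_split (e : ι) (f : Finset ι → ℝ) :
    ∑ s, f s = ∑ s ∈ (univ.erase e).powerset, (f s + f (insert e s)) := by
  have h : (univ : Finset (Finset ι)) = (insert e (univ.erase e)).powerset := by
    rw [Finset.insert_erase (mem_univ e), Finset.powerset_univ]
  rw [h, Finset.sum_powerset_insert (Finset.notMem_erase e univ), Finset.sum_add_distrib]

lemma wt_split (p : ℝ) (e : ι) (s : Finset ι) (h : e ∉ s) :
    (1 - p) * wt p (insert e s) = p * wt p s := by
  have h1 : wt p s = (1 - p) * ∏ i ∈ univ.erase e, if i ∈ s then p else 1 - p := by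
    rw [wt, ← Finset.mul_prod_erase univ _ (mem_univ e)]; simp [h]
  have h2 : wt p (insert e s) = p * ∏ i ∈ univ.erase e, if i ∈ s then p else 1 - p := by
    rw [wt, ← Finset.mul_prod_erase univ _ (mem_univ e)]
    simp only [mem_insert_self, if_true]
    congr 1
    refine Finset.prod_congr rfl fun i hi => ?_
    have : i ≠ e := (Finset.mem_erase.1 hi).1
    simp [this]
  rw [h1, h2]; ring

lemma Ex_one (p : ℝ) : Ex (ι := ι) p (fun _ => 1) = 1 := by
  have := Finset.prod_add (fun _ : ι => p) (fun _ => 1 - p) univ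
  simp only [add_sub_cancel, Finset.prod_const_one, Finset.powerset_univ] at this
  refine Eq.trans ?_ this.symm
  rw [Ex]
  refine Finset.sum_congr rfl fun s _ => ?_
  rw [mul_one, wt, Finset.prod_ite]
  congr 1
  · congr 1; ext; simp
  · congr 1; ext; simp

lemma key1 (p : ℝ) (e : ι) (g : Finset ι → ℝ) :
    Ex p (fun s => if e ∈ s then g s else 0) = p * Ex p (fun s => g (insert e s)) := by
  simp only [Ex]
  rw [sum_split e, sum_split e, Finset.mul_sum]
  refine Finset.sum_congr rfl fun s hs => ?_
  have he : e ∉ s := fun h => by simpa using (Finset.mem_powerset.1 hs h)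
  simp only [he, if_false, mem_insert_self, if_true, Finset.insert_idem]
  linear_combination (g (insert e s)) * wt_split p e s he

lemma key (p : ℝ) (S : Finset ι) : ∀ (g : Finset ι → ℝ),
    Ex p (fun s => if S ⊆ s then g s else 0) = p ^ #S * Ex p (fun s => g (s ∪ S)) := by
  induction S using Finset.induction_on with
  | empty => intro g; simp
  | insert e S he ih =>
    intro g
    have h1 : (fun s => if insert e S ⊆ s then g s else 0)
        = (fun s => if e ∈ s then (if S ⊆ s then g s else 0) else 0) := by
      funext s
      by_cases h : e ∈ s <;> by_cases h' : S ⊆ s <;> simp [h, h', Finset.insert_subset_iff]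
    rw [h1, key1]
    have h2 : (fun s => if S ⊆ insert e s then g (insert e s) else 0)
        = (fun s => if S ⊆ s then g (insert e s) else 0) := by
      funext s
      simp only [Finset.subset_insert_iff_of_notMem he]
    rw [h2, ih (fun s => g (insert e s)), Finset.card_insert_of_notMem he]
    simp only [Finset.union_insert]
    ring

/-- indicator that no member of F is contained in s -/
def av (F : Finset (Finset ι)) (s : Finset ι) : ℝ := if ∀ S ∈ F, ¬ S ⊆ s then 1 else 0

lemma av_nonneg (F : Finset (Finset ι)) (s : Finset ι) : 0 ≤ av F s := by
  unfold av; split_ifs <;> norm_num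

lemma av_le_one (F : Finset (Finset ι)) (s : Finset ι) : av F s ≤ 1 := by
  unfold av; split_ifs <;> norm_num

lemma av_anti {F G : Finset (Finset ι)} {s t : Finset ι} (hF : F ⊆ G) (hs : s ⊆ t) :
    av G t ≤ av F s := by
  unfold av
  split_ifs with h1 h2
  · rfl
  · exact absurd (fun S hS h => h1 S (hF hS) (h.trans hs)) h2
  · norm_num
  · rfl

lemma av_insert (S : Finset ι) (F : Finset (Finset ι)) (s : Finset ι) :
    av (insert S F) s = av F s - (if S ⊆ s then av F s else 0) := by
  unfold av
  by_cases h : S ⊆ s <;> simp [h]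

lemma Ex_av_nonneg {p : ℝ} (h0 : 0 ≤ p) (h1 : p ≤ 1) (F : Finset (Finset ι)) :
    0 ≤ Ex p (av F) :=
  Finset.sum_nonneg fun s _ => mul_nonneg (wt_nonneg h0 h1 s) (av_nonneg F s)

lemma harris {p : ℝ} (h0 : 0 ≤ p) (h1 : p ≤ 1) (F : Finset (Finset ι)) (S : Finset ι) :
    Ex p (fun s => if S ⊆ s then av F s else 0) ≤ p ^ #S * Ex p (av F) := by
  rw [key]
  refine mul_le_mul_of_nonneg_left (Ex_mono h0 h1 fun s => ?_) (pow_nonneg h0 _)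
  exact av_anti (subset_refl _) Finset.subset_union_left

lemma lower_bound {p : ℝ} (h0 : 0 ≤ p) (h1 : p ≤ 1) (F : Finset (Finset ι)) :
    ∏ S ∈ F, (1 - p ^ #S) ≤ Ex p (av F) := by
  induction F using Finset.induction_on with
  | empty =>
    have : (av (∅ : Finset (Finset ι))) = fun _ => 1 := by funext s; simp [av]
    rw [this, Ex_one]; simp
  | insert S F hS ih =>
    rw [Finset.prod_insert hS]
    have : av (insert S F) = fun s => av F s - (if S ⊆ s then av F s else 0) :=
      funext (av_insert S F)
    rw [this, Ex_sub]
    have h2 := harris h0 h1 F S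
    have h3 : (1 - p ^ #S) * ∏ S ∈ F, (1 - p ^ #S) ≤ (1 - p ^ #S) * Ex p (av F) :=
      mul_le_mul_of_nonneg_left ih (by linarith [pow_le_one₀ (n := #S) h0 h1])
    linarith

lemma janson_step {p : ℝ} (h0 : 0 ≤ p) (h1 : p ≤ 1) (F : Finset (Finset ι)) (S : Finset ι) :
    Ex p (av (insert S F)) ≤
      (1 - (p ^ #S - ∑ T ∈ F with ¬ Disjoint S T, p ^ #(S ∪ T))) * Ex p (av F) := by
  have e1 : av (insert S F) = fun s => av F s - (if S ⊆ s then av F s else 0) :=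
    funext (av_insert S F)
  rw [e1, Ex_sub]
  set r := p ^ #S - ∑ T ∈ F with ¬ Disjoint S T, p ^ #(S ∪ T) with hr
  have hge : 0 ≤ Ex p (fun s => if S ⊆ s then av F s else 0) :=
    Finset.sum_nonneg fun s _ => mul_nonneg (wt_nonneg h0 h1 s) (by
      dsimp only
      split_ifs
      · exact av_nonneg _ _
      · exact le_rfl)
  have hF0 := Ex_av_nonneg h0 h1 F
  suffices r * Ex p (av F) ≤ Ex p (fun s => if S ⊆ s then av F s else 0) by linarith
  rcases le_total r 0 with hr0 | hr0
  · exact (mul_nonpos_of_nonpos_of_nonneg hr0 hF0).trans hge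
  set B := F.filter (fun T => Disjoint S T) with hB
  set N := F.filter (fun T => ¬ Disjoint S T) with hN
  have hBF : Ex p (av F) ≤ Ex p (av B) :=
    Ex_mono h0 h1 fun s => av_anti (Finset.filter_subset _ _) (subset_refl _)
  refine (mul_le_mul_of_nonneg_left hBF hr0).trans ?_
  have hBS : Ex p (fun s => if S ⊆ s then av B s else 0) = p ^ #S * Ex p (av B) := by
    rw [key]
    congr 2
    funext s
    unfold av
    congr 1
    refine propext (forall₂_congr fun T hT => not_congr ?_)
    have hd : Disjoint S T := (Finset.mem_filter.1 hT).2
    constructor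
    · intro h x hx
      rcases Finset.mem_union.1 (h hx) with h' | h'
      · exact h'
      · exact absurd hx (Finset.disjoint_left.1 hd h')
    · intro h; exact h.trans Finset.subset_union_left
  have hpt : ∀ s, (if S ⊆ s then av B s else 0) - ∑ T ∈ N, (if S ∪ T ⊆ s then av B s else 0)
      ≤ (if S ⊆ s then av F s else 0) := by
    intro s
    have hsum : 0 ≤ ∑ T ∈ N, (if S ∪ T ⊆ s then av B s else 0) :=
      Finset.sum_nonneg fun T _ => by
        split_ifs
        · exact av_nonneg _ _
        · exact le_rfl
    by_cases hS : S ⊆ s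
    · simp only [hS, if_true]
      by_cases hex : ∃ T ∈ N, T ⊆ s
      · obtain ⟨T, hT, hTs⟩ := hex
        have : av B s ≤ ∑ T ∈ N, (if S ∪ T ⊆ s then av B s else 0) := by
          have := Finset.single_le_sum (f := fun T => if S ∪ T ⊆ s then av B s else 0)
            (fun T _ => by
              split_ifs
              · exact av_nonneg _ _
              · exact le_rfl) hT
          simpa [Finset.union_subset hS hTs] using this
        linarith [av_nonneg F s]
      · push Not at hex
        have : av B s ≤ av F s := by
          unfold av
          split_ifs with h3 h4
          · rfl
          · refine absurd (fun T hT => ?_) h4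
            by_cases hd : Disjoint S T
            · exact h3 T (Finset.mem_filter.2 ⟨hT, hd⟩)
            · exact hex T (Finset.mem_filter.2 ⟨hT, hd⟩)
          · norm_num
          · rfl
        linarith
    · simp only [hS, if_false]
      linarith
  have h4 := Ex_mono h0 h1 hpt
  rw [Ex_sub, Ex_sum, hBS] at h4
  have h5 : ∑ T ∈ N, Ex p (fun s => if S ∪ T ⊆ s then av B s else 0)
      ≤ ∑ T ∈ N, p ^ #(S ∪ T) * Ex p (av B) :=
    Finset.sum_le_sum fun T _ => harris h0 h1 B (S ∪ T)
  rw [← Finset.sum_mul] at h5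
  rw [hr, sub_mul]
  linarith

lemma janson {p : ℝ} (h0 : 0 ≤ p) (h1 : p ≤ 1) (F : Finset (Finset ι)) :
    Ex p (av F) ≤ Real.exp (- ∑ S ∈ F, p ^ #S
      + ∑ S ∈ F, ∑ T ∈ F with (S ≠ T ∧ ¬ Disjoint S T), p ^ #(S ∪ T)) := by
  induction F using Finset.induction_on with
  | empty =>
    have : (av (∅ : Finset (Finset ι))) = fun _ => 1 := by funext s; simp [av]
    rw [this, Ex_one]; simp
  | insert S F hS ih =>
    have h2 := janson_step h0 h1 F S
    have hF0 := Ex_av_nonneg h0 h1 F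
    set r := p ^ #S - ∑ T ∈ F with ¬ Disjoint S T, p ^ #(S ∪ T) with hr
    have h3 : (1 - r) ≤ Real.exp (-r) := by linarith [Real.add_one_le_exp (-r)]
    refine h2.trans ((mul_le_mul_of_nonneg_right h3 hF0).trans
      ((mul_le_mul_of_nonneg_left ih (Real.exp_pos _).le).trans ?_))
    rw [← Real.exp_add]
    apply Real.exp_le_exp.2
    rw [Finset.sum_insert hS, Finset.sum_insert hS]
    have h4 : ∑ T ∈ F with ¬ Disjoint S T, p ^ #(S ∪ T)
        ≤ ∑ T ∈ insert S F with (S ≠ T ∧ ¬ Disjoint S T), p ^ #(S ∪ T) := by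
      refine Finset.sum_le_sum_of_subset_of_nonneg ?_ (fun _ _ _ => pow_nonneg h0 _)
      intro T hT
      rw [Finset.mem_filter] at hT ⊢
      refine ⟨Finset.mem_insert_of_mem hT.1, ?_, hT.2⟩
      rintro rfl; exact hS hT.1
    have h5 : ∑ U ∈ F, ∑ T ∈ F with (U ≠ T ∧ ¬ Disjoint U T), p ^ #(U ∪ T)
        ≤ ∑ U ∈ F, ∑ T ∈ insert S F with (U ≠ T ∧ ¬ Disjoint U T), p ^ #(U ∪ T) := by
      refine Finset.sum_le_sum fun U _ => ?_
      refine Finset.sum_le_sum_of_subset_of_nonneg ?_ (fun _ _ _ => pow_nonneg h0 _)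
      exact Finset.filter_subset_filter _ (Finset.subset_insert _ _)
    rw [hr]
    linarith

end Prob

section Comb
open Equiv Equiv.Perm

variable {n : ℕ}

lemma inv_app (σ : Perm (Fin n)) (x : Fin n) : σ⁻¹ (σ x) = x := σ.symm_apply_apply x

def edg (σ : Perm (Fin n)) : Finset (FaceIdx n 1) :=
  univ.filter (fun e => ∃ x, σ x ≠ x ∧ e.1 = {x, σ x})

def IsC (σ : Perm (Fin n)) : Prop := σ.IsCycle ∧ 3 ≤ #σ.support

lemma IsC.inv {σ : Perm (Fin n)} (h : IsC σ) : IsC σ⁻¹ :=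
  ⟨h.1.inv, by rw [Equiv.Perm.support_inv]; exact h.2⟩

lemma IsC.sq_ne {σ : Perm (Fin n)} (h : IsC σ) {x : Fin n} (hx : σ x ≠ x) : σ (σ x) ≠ x := by
  intro h2
  have h3 : σ ^ 2 = 1 := (h.1.pow_eq_one_iff).2 ⟨x, hx, by simpa [sq] using h2⟩
  have h4 := orderOf_dvd_of_pow_eq_one h3
  rw [h.1.orderOf] at h4
  have := Nat.le_of_dvd (by norm_num) h4
  have := h.2
  omega

lemma pair_eq {a b c d : Fin n} (h : ({a, b} : Finset (Fin n)) = {c, d}) :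
    (a = c ∧ b = d) ∨ (a = d ∧ b = c) := by
  have h' := congrArg (fun s : Finset (Fin n) => (s : Set (Fin n))) h
  simp only [Finset.coe_pair] at h'
  exact Set.pair_eq_pair_iff.1 h'

lemma card_edg {σ : Perm (Fin n)} (h : IsC σ) : #(edg σ) = #σ.support := by
  symm
  refine Finset.card_bij
    (fun x hx => ⟨{x, σ x}, Finset.card_pair (Ne.symm (Perm.mem_support.1 hx))⟩) ?_ ?_ ?_
  · intro x hx
    exact Finset.mem_filter.2 ⟨mem_univ _, x, Perm.mem_support.1 hx, rfl⟩
  · intro x hx y hy hxy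
    rcases pair_eq (Subtype.ext_iff.1 hxy) with ⟨h1, _⟩ | ⟨h1, h2⟩
    · exact h1
    · exact absurd (by rw [h2, ← h1]) (h.sq_ne (Perm.mem_support.1 hx))
  · intro e he
    obtain ⟨-, x, hx, hex⟩ := Finset.mem_filter.1 he
    exact ⟨x, Perm.mem_support.2 hx, Subtype.ext hex.symm⟩

lemma edg_inv_sub (σ : Perm (Fin n)) : edg σ ⊆ edg σ⁻¹ := by
  intro e he
  obtain ⟨-, x, hx, hex⟩ := Finset.mem_filter.1 he
  refine Finset.mem_filter.2 ⟨mem_univ _, σ x, ?_, ?_⟩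
  · rw [inv_app]; exact hx.symm
  · rw [inv_app, hex, Finset.pair_comm]

lemma edg_inv (σ : Perm (Fin n)) : edg σ⁻¹ = edg σ :=
  Finset.Subset.antisymm (by simpa using edg_inv_sub σ⁻¹) (edg_inv_sub σ)

lemma mem_edg_mk {σ : Perm (Fin n)} {x y : Fin n} (h : #({x, y} : Finset (Fin n)) = 1 + 1)
    (he : (⟨{x, y}, h⟩ : FaceIdx n 1) ∈ edg σ) : y = σ x ∨ σ y = x := by
  obtain ⟨-, z, hz, hex⟩ := Finset.mem_filter.1 he
  rcases pair_eq hex with ⟨h1, h2⟩ | ⟨h1, h2⟩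
  · left; rw [h2, h1]
  · right; rw [h1, h2]

lemma eq_of_agree {σ τ : Perm (Fin n)} (hσ : IsC σ) (hτ : IsC τ)
    (H : ∀ x, τ x ≠ x → τ x = σ x ∨ σ (τ x) = x) (x0 : Fin n) (h0 : τ x0 ≠ x0)
    (h1 : τ x0 = σ x0) : τ = σ := by
  have mv : ∀ k : ℕ, τ ((τ ^ k) x0) ≠ (τ ^ k) x0 := by
    intro k hk
    apply h0
    have : (τ ^ k) (τ x0) = (τ ^ k) x0 := by
      rw [← Perm.mul_apply, ← pow_succ, pow_succ', Perm.mul_apply, hk]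
    exact (τ ^ k).injective this
  have st : ∀ k : ℕ, τ ((τ ^ k) x0) = σ ((τ ^ k) x0) := by
    intro k
    induction k with
    | zero => simpa using h1
    | succ k ih =>
      have e : (τ ^ (k + 1)) x0 = τ ((τ ^ k) x0) := by rw [pow_succ', Perm.mul_apply]
      have := mv (k + 1)
      rcases H _ this with h2 | h2
      · exact h2
      · exfalso
        rw [e] at h2
        have h3 : σ (τ (τ ((τ ^ k) x0))) = σ ((τ ^ k) x0) := by rw [h2, ih]
        exact hτ.sq_ne (mv k) (σ.injective h3)
  have eqp : ∀ k : ℕ, (σ ^ k) x0 = (τ ^ k) x0 := by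
    intro k
    induction k with
    | zero => simp
    | succ k ih => rw [pow_succ', pow_succ', Perm.mul_apply, Perm.mul_apply, ih, st k]
  have h0' : σ x0 ≠ x0 := by rw [← h1]; exact h0
  ext1 x
  by_cases hx : τ x = x
  · by_cases hx' : σ x = x
    · rw [hx, hx']
    · obtain ⟨k, hk⟩ := hσ.1.exists_pow_eq h0' hx'
      rw [← hk, eqp k, st k]
  · obtain ⟨k, hk⟩ := hτ.1.exists_pow_eq h0 hx
    rw [← hk, st k]

lemma edg_sub {σ τ : Perm (Fin n)} (hσ : IsC σ) (hτ : IsC τ) (h : edg τ ⊆ edg σ) :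
    τ = σ ∨ τ = σ⁻¹ := by
  have H : ∀ x, τ x ≠ x → τ x = σ x ∨ σ (τ x) = x := by
    intro x hx
    have hc : #({x, τ x} : Finset (Fin n)) = 1 + 1 := Finset.card_pair hx.symm
    have : (⟨{x, τ x}, hc⟩ : FaceIdx n 1) ∈ edg τ :=
      Finset.mem_filter.2 ⟨mem_univ _, x, hx, rfl⟩
    exact mem_edg_mk hc (h this)
  obtain ⟨x0, h0, -⟩ := hτ.1
  rcases H x0 h0 with h1 | h1
  · exact Or.inl (eq_of_agree hσ hτ H x0 h0 h1)
  · right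
    refine eq_of_agree hσ.inv hτ (fun x hx => ?_) x0 h0 ?_
    · rcases H x hx with h2 | h2
      · right; rw [h2, inv_app]
      · left; rw [Perm.eq_inv_iff_eq]; exact h2
    · rw [Perm.eq_inv_iff_eq]; exact h1

lemma edg_eq_of_sub {σ τ : Perm (Fin n)} (hσ : IsC σ) (hτ : IsC τ) (h : edg τ ⊆ edg σ) :
    edg τ = edg σ := by
  rcases edg_sub hσ hτ h with rfl | rfl
  · rfl
  · exact edg_inv σ

lemma union_card {σ τ : Perm (Fin n)} (hσ : IsC σ) (hτ : IsC τ) (hne : edg σ ≠ edg τ)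
    (hd : ¬ Disjoint (edg σ) (edg τ)) :
    #(σ.support ∪ τ.support) + 1 ≤ #(edg σ ∪ edg τ) := by
  have e1 := Finset.card_union_add_card_inter σ.support τ.support
  have e2 := Finset.card_union_add_card_inter (edg σ) (edg τ)
  rw [card_edg hσ, card_edg hτ] at e2
  suffices #(edg σ ∩ edg τ) + 1 ≤ #(σ.support ∩ τ.support) by omega
  set X : Finset (Fin n) := univ.filter (fun x => τ x ≠ x ∧ ∃ y, σ y ≠ y ∧
    ({x, τ x} : Finset (Fin n)) = {y, σ y}) with hX
  have hcard : #(edg σ ∩ edg τ) = #X := by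
    symm
    refine Finset.card_bij
      (fun x hx => ⟨{x, τ x}, Finset.card_pair (Ne.symm (Finset.mem_filter.1 hx).2.1)⟩) ?_ ?_ ?_
    · intro x hx
      obtain ⟨-, h1, h2⟩ := Finset.mem_filter.1 hx
      exact Finset.mem_inter.2 ⟨Finset.mem_filter.2 ⟨mem_univ _, h2⟩,
        Finset.mem_filter.2 ⟨mem_univ _, x, h1, rfl⟩⟩
    · intro x hx y hy hxy
      rcases pair_eq (Subtype.ext_iff.1 hxy) with ⟨h1, _⟩ | ⟨h1, h2⟩
      · exact h1
      · exact absurd (by rw [h2, ← h1]) (hτ.sq_ne (Finset.mem_filter.1 hx).2.1)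
    · intro e he
      obtain ⟨h1, h2⟩ := Finset.mem_inter.1 he
      obtain ⟨-, y, hy, hey⟩ := Finset.mem_filter.1 h1
      obtain ⟨-, x, hx, hex⟩ := Finset.mem_filter.1 h2
      exact ⟨x, Finset.mem_filter.2 ⟨mem_univ _, hx, y, hy, by rw [← hex, hey]⟩,
        Subtype.ext hex.symm⟩
  have hsub : X ∪ X.image τ ⊆ σ.support ∩ τ.support := by
    intro z hz
    rcases Finset.mem_union.1 hz with hz | hz
    · obtain ⟨-, h1, y, hy, h2⟩ := Finset.mem_filter.1 hz
      refine Finset.mem_inter.2 ⟨?_, Perm.mem_support.2 h1⟩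
      rcases pair_eq h2 with ⟨h3, _⟩ | ⟨h3, _⟩
      · rw [h3]; exact Perm.mem_support.2 hy
      · rw [h3]; exact Perm.apply_mem_support.2 (Perm.mem_support.2 hy)
    · obtain ⟨x, hx, rfl⟩ := Finset.mem_image.1 hz
      obtain ⟨-, h1, y, hy, h2⟩ := Finset.mem_filter.1 hx
      refine Finset.mem_inter.2 ⟨?_, Perm.apply_mem_support.2 (Perm.mem_support.2 h1)⟩
      rcases pair_eq h2 with ⟨_, h3⟩ | ⟨_, h3⟩
      · rw [h3]; exact Perm.apply_mem_support.2 (Perm.mem_support.2 hy)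
      · rw [h3]; exact Perm.mem_support.2 hy
  have hne' : ¬ X.image τ ⊆ X := by
    intro hinv
    obtain ⟨e, he1, he2⟩ := Finset.not_disjoint_iff.1 hd
    have : 0 < #X := by
      rw [← hcard]; exact Finset.card_pos.2 ⟨e, Finset.mem_inter.2 ⟨he1, he2⟩⟩
    obtain ⟨x0, hx0⟩ := Finset.card_pos.1 this
    have hpow : ∀ k : ℕ, (τ ^ k) x0 ∈ X := by
      intro k
      induction k with
      | zero => simpa using hx0
      | succ k ih =>
        rw [pow_succ', Perm.mul_apply]
        exact hinv (Finset.mem_image_of_mem _ ih)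
    apply hne
    symm
    apply edg_eq_of_sub hσ hτ
    intro e he
    obtain ⟨-, x, hx, hex⟩ := Finset.mem_filter.1 he
    obtain ⟨k, hk⟩ := hτ.1.exists_pow_eq (Finset.mem_filter.1 hx0).2.1 hx
    have hxX := hpow k
    rw [hk] at hxX
    obtain ⟨-, h1, y, hy, h2⟩ := Finset.mem_filter.1 hxX
    exact Finset.mem_filter.2 ⟨mem_univ _, y, hy, by rw [hex, h2]⟩
  rw [hcard]
  refine le_trans ?_ (Finset.card_le_card hsub)
  apply Finset.card_lt_card
  refine Finset.ssubset_iff_subset_ne.2 ⟨Finset.subset_union_left, fun h => hne' ?_⟩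
  rw [h]; exact fun z hz => Finset.mem_union_right _ (by rwa [← h] at hz)

def cycP (n j : ℕ) : Finset (Perm (Fin n)) := univ.filter (fun σ => σ.cycleType = {j})

lemma mem_cycP {j : ℕ} {σ : Perm (Fin n)} : σ ∈ cycP n j ↔ σ.IsCycle ∧ #σ.support = j := by
  simp only [cycP, Finset.mem_filter, mem_univ, true_and]
  constructor
  · intro h
    have hc : σ.IsCycle := by rw [← Equiv.Perm.card_cycleType_eq_one, h]; simp
    refine ⟨hc, ?_⟩
    rw [hc.cycleType] at h
    simpa using h
  · rintro ⟨h, h'⟩; rw [h.cycleType, h']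

def cyc (n j : ℕ) : Finset (Finset (FaceIdx n 1)) := (cycP n j).image edg

lemma mem_cyc {j : ℕ} (hj : 3 ≤ j) {S : Finset (FaceIdx n 1)} (h : S ∈ cyc n j) :
    ∃ σ, IsC σ ∧ #σ.support = j ∧ edg σ = S := by
  obtain ⟨σ, hσ, rfl⟩ := Finset.mem_image.1 h
  obtain ⟨h1, h2⟩ := mem_cycP.1 hσ
  exact ⟨σ, ⟨h1, h2 ▸ hj⟩, h2, rfl⟩

lemma cyc_card_mem {j : ℕ} (hj : 3 ≤ j) {S : Finset (FaceIdx n 1)} (h : S ∈ cyc n j) :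
    #S = j := by
  obtain ⟨σ, h1, h2, rfl⟩ := mem_cyc hj h
  rw [card_edg h1, h2]

lemma card_cyc {j : ℕ} (hj : 3 ≤ j) : 2 * j * #(cyc n j) = n.descFactorial j := by
  set A := cycP n j with hA
  have h1 : #A = #(cyc n j) * 2 := by
    rw [Finset.card_eq_sum_card_image edg A]
    refine Finset.sum_const_nat fun S hS => ?_
    obtain ⟨σ, hσ, rfl⟩ := Finset.mem_image.1 hS
    obtain ⟨h1, h2⟩ := mem_cycP.1 hσ
    have hC : IsC σ := ⟨h1, h2 ▸ hj⟩
    have : A.filter (fun τ => edg τ = edg σ) = {σ, σ⁻¹} := by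
      ext τ
      simp only [Finset.mem_filter, Finset.mem_insert, Finset.mem_singleton]
      constructor
      · rintro ⟨hτ, he⟩
        obtain ⟨h3, h4⟩ := mem_cycP.1 hτ
        exact edg_sub hC ⟨h3, h4 ▸ hj⟩ he.subset
      · rintro (rfl | rfl)
        · exact ⟨hσ, rfl⟩
        · refine ⟨mem_cycP.2 ⟨hC.inv.1, ?_⟩, edg_inv σ⟩
          rw [Equiv.Perm.support_inv, h2]
    rw [this, Finset.card_pair]
    intro heq
    obtain ⟨x, hx, -⟩ := h1
    apply hC.sq_ne hx
    rw [← Perm.eq_inv_iff_eq, ← heq]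
  rcases le_or_gt j n with hjn | hjn
  · have h3 := Equiv.Perm.card_of_cycleType_singleton (α := Fin n) (n := j) (by omega)
      (by simpa using hjn)
    change #A = _ at h3
    rw [h1, Fintype.card_fin] at h3
    rw [Nat.descFactorial_eq_factorial_mul_choose, ← Nat.mul_factorial_pred (by omega : j ≠ 0),
      mul_assoc j, ← h3]
    ring
  · rw [Nat.descFactorial_eq_zero_iff_lt.2 hjn]
    have : A = ∅ := by
      rw [Finset.eq_empty_iff_forall_notMem]
      intro σ hσ
      have h3 := (mem_cycP.1 hσ).2
      have h4 := Finset.card_le_univ σ.support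
      rw [Fintype.card_fin] at h4
      omega
    rw [this] at h1
    simp at h1
    simp [h1]

end Comb

section Graph
open Equiv Equiv.Perm

variable {n : ℕ}

lemma adj_of_edge {ω : FaceIdx n 1 → Bool} {x y : Fin n} (hxy : x ≠ y)
    (h : ω ⟨{x, y}, Finset.card_pair hxy⟩ = true) : (graphOf n ω).Adj x y :=
  ⟨hxy, _, h, by simp, by simp⟩

lemma edge_of_adj {ω : FaceIdx n 1 → Bool} {x y : Fin n} (h : (graphOf n ω).Adj x y)
    (e : FaceIdx n 1) (he : e.1 = {x, y}) : ω e = true := by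
  obtain ⟨hne, e', h1, h2, h3⟩ := h
  have : ({x, y} : Finset (Fin n)) = e'.1 := by
    apply Finset.eq_of_subset_of_card_le
    · intro z hz
      rcases Finset.mem_insert.1 hz with rfl | hz
      · exact h2
      · rw [Finset.mem_singleton.1 hz]; exact h3
    · rw [e'.2, Finset.card_pair hne]
  have : e = e' := Subtype.ext (he.trans this)
  rw [this]; exact h1

lemma not_acyclic_of_cyc {ω : FaceIdx n 1 → Bool} {σ : Perm (Fin n)} (hσ : IsC σ)
    (h : ∀ e ∈ edg σ, ω e = true) : ¬ (graphOf n ω).IsAcyclic := by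
  intro hac
  obtain ⟨x, hx, -⟩ := id hσ.1
  have adj : ∀ y, σ y ≠ y → (graphOf n ω).Adj y (σ y) := fun y hy =>
    adj_of_edge hy.symm (h _ (Finset.mem_filter.2 ⟨mem_univ _, y, hy, rfl⟩))
  have mv : ∀ k : ℕ, σ ((σ ^ k) x) ≠ (σ ^ k) x := by
    intro k hk
    apply hx
    have : (σ ^ k) (σ x) = (σ ^ k) x := by
      rw [← Perm.mul_apply, ← pow_succ, pow_succ', Perm.mul_apply, hk]
    exact (σ ^ k).injective this
  have hb := SimpleGraph.isAcyclic_iff_forall_adj_isBridge.1 hac (adj x hx)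
  rw [SimpleGraph.isBridge_iff] at hb
  apply hb
  have reach : ∀ k : ℕ, k + 1 ≤ #σ.support →
      ((graphOf n ω).deleteEdges {s(x, σ x)}).Reachable (σ x) ((σ ^ (k + 1)) x) := by
    intro k
    induction k with
    | zero => intro _; simp
    | succ k ih =>
      intro hk
      refine (ih (by omega)).trans (SimpleGraph.Adj.reachable ?_)
      rw [SimpleGraph.deleteEdges_adj]
      have e : (σ ^ (k + 1 + 1)) x = σ ((σ ^ (k + 1)) x) := by rw [pow_succ', Perm.mul_apply]
      rw [e]
      refine ⟨adj _ (mv _), ?_⟩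
      intro hmem
      have hne : (σ ^ (k + 1)) x ≠ x := by
        intro hh
        have h3 : σ ^ (k + 1) = 1 := (hσ.1.pow_eq_one_iff).2 ⟨x, hx, hh⟩
        have h4 := orderOf_dvd_of_pow_eq_one h3
        rw [hσ.1.orderOf] at h4
        have := Nat.le_of_dvd (by omega) h4
        omega
      rcases Sym2.eq_iff.1 (Set.mem_singleton_iff.1 hmem) with ⟨h1, _⟩ | ⟨h1, h2⟩
      · exact hne h1
      · rw [h1] at h2; exact hσ.sq_ne hx h2
  have h3 := hσ.2
  have := reach (#σ.support - 1) (by omega)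
  rw [Nat.sub_add_cancel (by omega), ← hσ.1.orderOf, pow_orderOf_eq_one] at this
  exact this.symm

lemma exists_cyc_of_not_acyclic {ω : FaceIdx n 1 → Bool} (h : ¬ (graphOf n ω).IsAcyclic) :
    ∃ σ : Perm (Fin n), IsC σ ∧ ∀ e ∈ edg σ, ω e = true := by
  unfold SimpleGraph.IsAcyclic at h
  push Not at h
  obtain ⟨v, w, hw⟩ := h
  set l := w.support.tail with hl
  have hnd : l.Nodup := hw.support_nodup
  have hlen : l.length = w.length := by simp [hl]
  have h3 := hw.three_le_length
  have hget : ∀ i (hi : i < l.length), l[i] = w.getVert (i + 1) := by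
    intro i hi
    simp only [hl, List.getElem_tail]
    rw [SimpleGraph.Walk.support_getElem_eq_getVert]
  refine ⟨l.formPerm, ⟨List.isCycle_formPerm hnd (by omega), ?_⟩, ?_⟩
  · rw [List.support_formPerm_of_nodup l hnd (by intro x hx; rw [hx] at hlen; simp at hlen; omega),
      List.toFinset_card_of_nodup hnd]
    omega
  · intro e he
    obtain ⟨-, x, hx, hex⟩ := Finset.mem_filter.1 he
    refine edge_of_adj ?_ e hex
    have hxl : x ∈ l := List.mem_of_formPerm_apply_ne hx
    obtain ⟨i, hi, rfl⟩ := List.getElem_of_mem hxl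
    rw [List.formPerm_apply_getElem l hnd i hi, hget, hget]
    rcases Nat.lt_or_ge (i + 1) l.length with h4 | h4
    · rw [Nat.mod_eq_of_lt h4]
      exact w.adj_getVert_succ (by omega)
    · have h5 : i + 1 = l.length := by omega
      rw [h5, Nat.mod_self, hlen, w.getVert_length]
      have := w.adj_getVert_succ (i := 0) (by omega)
      simpa using this

lemma pi_real {p : ℝ} (h0 : 0 ≤ p) (h1 : p ≤ 1) (Q : (FaceIdx n 1 → Bool) → Prop)
    [DecidablePred Q] :
    YMeasure n 1 p {ω | Q ω} = ENNReal.ofReal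
      (Ex p (fun s : Finset (FaceIdx n 1) => if Q (fun e => decide (e ∈ s)) then 1 else 0)) := by
  have hb : ∀ b : Bool, bernoulliBool p {b} = ENNReal.ofReal (if b then p else 1 - p) := by
    intro b
    have : max 0 (min p 1) = p := by rw [min_eq_left h1, max_eq_right h0]
    cases b <;> simp [bernoulliBool, this]
  have hs : YMeasure n 1 p {ω | Q ω} = ∑ ω ∈ univ.filter Q, YMeasure n 1 p {ω} := by
    rw [MeasureTheory.sum_measure_singleton]
    congr 1
    ext; simp
  have hsing : ∀ ω, YMeasure n 1 p {ω} = ENNReal.ofReal (∏ e, if ω e then p else 1 - p) := by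
    intro ω
    rw [YMeasure, Measure.pi_singleton, ENNReal.ofReal_prod_of_nonneg]
    · simp only [hb]
    · intro i _; split_ifs <;> linarith
  rw [hs, Finset.sum_congr rfl (fun ω _ => hsing ω), ← ENNReal.ofReal_sum_of_nonneg]
  · congr 1
    rw [Finset.sum_filter, Ex]
    symm
    refine Finset.sum_bij' (fun s _ => fun e => decide (e ∈ s))
      (fun ω _ => univ.filter (fun e => ω e = true)) ?_ ?_ ?_ ?_ ?_
    · simp
    · simp
    · intro s _; ext; simp
    · intro ω _; funext e; simp
    · intro s _
      simp [wt]
  · intro ω _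
    refine Finset.prod_nonneg fun i _ => ?_
    split_ifs <;> linarith

end Graph

section Bounds
open Equiv Equiv.Perm

variable {n : ℕ}

def fam (n m : ℕ) : Finset (Finset (FaceIdx n 1)) := (range m).biUnion (fun i => cyc n (i + 3))

open Classical in
def acy (n : ℕ) (p : ℝ) : ℝ :=
  Ex p (fun s : Finset (FaceIdx n 1) =>
    if (graphOf n (fun e => decide (e ∈ s))).IsAcyclic then 1 else 0)

lemma measure_acy {p : ℝ} (h0 : 0 ≤ p) (h1 : p ≤ 1) :
    YMeasure n 1 p {ω | (graphOf n ω).IsAcyclic} = ENNReal.ofReal (acy n p) := by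
  classical
  rw [pi_real h0 h1, acy]

lemma measure_not_acy {p : ℝ} (h0 : 0 ≤ p) (h1 : p ≤ 1) :
    YMeasure n 1 p {ω | ¬ (graphOf n ω).IsAcyclic} = ENNReal.ofReal (1 - acy n p) := by
  classical
  rw [pi_real h0 h1]
  congr 1
  have e : (fun s : Finset (FaceIdx n 1) =>
      if ¬ (graphOf n (fun e => decide (e ∈ s))).IsAcyclic then (1 : ℝ) else 0)
      = fun s => 1 - if (graphOf n (fun e => decide (e ∈ s))).IsAcyclic then (1 : ℝ) else 0 := by
    funext s
    by_cases h : (graphOf n (fun e => decide (e ∈ s))).IsAcyclic <;> simp [h]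
  unfold acy
  refine (congrArg (Ex p) e).trans ?_
  rw [Ex_sub, Ex_one]

lemma acy_nonneg {p : ℝ} (h0 : 0 ≤ p) (h1 : p ≤ 1) : 0 ≤ acy n p := by
  unfold acy Ex
  exact Finset.sum_nonneg fun s _ => mul_nonneg (wt_nonneg h0 h1 s) (by beta_reduce; split_ifs <;> norm_num)

lemma acy_le (m : ℕ) {p : ℝ} (h0 : 0 ≤ p) (h1 : p ≤ 1) : acy n p ≤ Ex p (av (fam n m)) := by
  refine Ex_mono h0 h1 fun s => ?_
  split_ifs with h
  · rw [av, if_pos]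
    intro S hS hSs
    obtain ⟨i, hi, hS⟩ := Finset.mem_biUnion.1 hS
    obtain ⟨σ, h1, h2, rfl⟩ := mem_cyc (by omega) hS
    refine not_acyclic_of_cyc h1 (fun e he => ?_) h
    simpa using hSs he
  · exact av_nonneg _ _

lemma le_acy {p : ℝ} (h0 : 0 ≤ p) (h1 : p ≤ 1) : Ex p (av (fam n n)) ≤ acy n p := by
  refine Ex_mono h0 h1 fun s => ?_
  split_ifs with h
  · exact av_le_one _ _
  · rw [av, if_neg]
    intro hall
    obtain ⟨σ, hσ, he⟩ := exists_cyc_of_not_acyclic h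
    have hle := Finset.card_le_univ σ.support
    rw [Fintype.card_fin] at hle
    have h3 := hσ.2
    refine hall (edg σ) (Finset.mem_biUnion.2 ⟨#σ.support - 3, Finset.mem_range.2 (by omega), ?_⟩) ?_
    · exact Finset.mem_image_of_mem _ (mem_cycP.2 ⟨hσ.1, by omega⟩)
    · intro e hh; simpa using he e hh

lemma sum_fam (m : ℕ) (p : ℝ) :
    ∑ S ∈ fam n m, p ^ #S = ∑ i ∈ range m, (#(cyc n (i + 3)) : ℝ) * p ^ (i + 3) := by
  rw [fam, Finset.sum_biUnion]
  · refine Finset.sum_congr rfl fun i _ => ?_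
    rw [Finset.sum_congr rfl (fun S hS => by rw [cyc_card_mem (by omega) hS]), Finset.sum_const,
      nsmul_eq_mul]
  · intro i _ j _ hij
    refine Finset.disjoint_left.2 fun S h1 h2 => hij ?_
    have := cyc_card_mem (by omega) h1
    have := cyc_card_mem (by omega) h2
    omega

lemma card_cyc_real (i : ℕ) :
    (#(cyc n (i + 3)) : ℝ) = (n.descFactorial (i + 3) : ℝ) / (2 * (i + 3)) := by
  have := card_cyc (n := n) (j := i + 3) (by omega)
  rw [← this]
  have : (2 * ((i : ℝ) + 3)) ≠ 0 := by positivity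
  push_cast
  field_simp

def ff (c : ℝ) (i : ℕ) : ℝ := c ^ (i + 3) / (2 * (i + 3))

lemma term_eq {c : ℝ} (i : ℕ) : (#(cyc n (i + 3)) : ℝ) * (c / n) ^ (i + 3)
    = ((n.descFactorial (i + 3) : ℝ) / n ^ (i + 3)) * ff c i := by
  rw [card_cyc_real, ff, div_pow]; ring

lemma term_le {c : ℝ} (hc : 0 ≤ c) (i : ℕ) :
    (#(cyc n (i + 3)) : ℝ) * (c / n) ^ (i + 3) ≤ ff c i := by
  rw [term_eq]
  refine mul_le_of_le_one_left (by unfold ff; positivity) ?_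
  apply div_le_one_of_le₀ _ (by positivity)
  exact_mod_cast Nat.descFactorial_le_pow n (i + 3)

lemma tendsto_desc (j : ℕ) :
    Tendsto (fun n : ℕ => (n.descFactorial j : ℝ) / (n : ℝ) ^ j) atTop (nhds 1) := by
  induction j with
  | zero => simp
  | succ j ih =>
    have h1 : Tendsto (fun n : ℕ => (1 : ℝ) - (j : ℝ) / n) atTop (nhds (1 - 0)) :=
      tendsto_const_nhds.sub (tendsto_const_div_atTop_nhds_zero_nat _)
    have h2 := h1.mul ih
    simp only [sub_zero, mul_one] at h2
    refine h2.congr' ?_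
    filter_upwards [eventually_ge_atTop (j + 1)] with n hn
    rw [Nat.descFactorial_succ]
    have hn0 : (n : ℝ) ≠ 0 := by
      have : 0 < n := by omega
      positivity
    push_cast [Nat.cast_sub (by omega : j ≤ n)]
    field_simp
    ring

lemma lam_tendsto (c : ℝ) (m : ℕ) :
    Tendsto (fun n : ℕ => ∑ S ∈ fam n m, (c / n) ^ #S) atTop (nhds (∑ i ∈ range m, ff c i)) := by
  simp only [sum_fam, term_eq]
  refine tendsto_finsetSum _ fun i _ => ?_
  simpa using (tendsto_desc (i + 3)).mul_const (ff c i)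

lemma exp_bound {x p : ℝ} (h0 : 0 ≤ x) (hx : x ≤ p) (hp : p < 1) :
    Real.exp (- (x / (1 - p))) ≤ 1 - x := by
  have h1 : 0 < 1 - x := by linarith
  have h2 : 0 < 1 - p := by linarith
  have h3 : x / (1 - x) ≤ x / (1 - p) := div_le_div_of_nonneg_left h0 h2 (by linarith)
  have h4 : (1 - x)⁻¹ ≤ Real.exp (x / (1 - p)) := by
    have := Real.add_one_le_exp (x / (1 - p))
    have h5 : (1 - x)⁻¹ = x / (1 - x) + 1 := by field_simp; ring
    rw [h5]; linarith
  rw [Real.exp_neg]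
  exact inv_le_of_inv_le₀ h1 h4

lemma acy_lower {c L : ℝ} (hc : 0 < c) (hc1 : c < 1) (hL : ∀ m, ∑ i ∈ range m, ff c i ≤ L)
    (hn : 1 ≤ n) : Real.exp (- (L / (1 - c / n))) ≤ acy n (c / n) := by
  have hn1 : (1 : ℝ) ≤ n := by exact_mod_cast hn
  have h0 : 0 ≤ c / n := by positivity
  have h1 : c / n < 1 := by rw [div_lt_one (by linarith)]; linarith
  refine le_trans ?_ ((lower_bound h0 h1.le (fam n n)).trans (le_acy h0 h1.le))
  calc Real.exp (- (L / (1 - c / n)))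
      ≤ Real.exp (- ((∑ S ∈ fam n n, (c / n) ^ #S) / (1 - c / n))) := by
        apply Real.exp_le_exp.2
        apply neg_le_neg
        refine div_le_div_of_nonneg_right ?_ (by linarith)
        rw [sum_fam]
        exact (Finset.sum_le_sum fun i _ => term_le hc.le i).trans (hL n)
    _ = ∏ S ∈ fam n n, Real.exp (- ((c / n) ^ #S / (1 - c / n))) := by
        rw [← Real.exp_sum, Finset.sum_neg_distrib, Finset.sum_div]
    _ ≤ ∏ S ∈ fam n n, (1 - (c / n) ^ #S) := by
        refine Finset.prod_le_prod (fun _ _ => (Real.exp_pos _).le) fun S hS => ?_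
        refine exp_bound (pow_nonneg h0 _) ?_ h1
        obtain ⟨i, hi, hS⟩ := Finset.mem_biUnion.1 hS
        rw [cyc_card_mem (by omega) hS]
        exact pow_le_of_le_one h0 h1.le (by omega)

def vs (S : Finset (FaceIdx n 1)) : Finset (Fin n) := S.biUnion (fun e => e.1)

lemma vs_edg (σ : Perm (Fin n)) : vs (edg σ) = σ.support := by
  ext z
  simp only [vs, Finset.mem_biUnion, Perm.mem_support]
  constructor
  · rintro ⟨e, he, hz⟩
    obtain ⟨-, x, hx, hex⟩ := Finset.mem_filter.1 he
    rw [hex] at hz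
    rcases Finset.mem_insert.1 hz with rfl | hz
    · exact hx
    · rw [Finset.mem_singleton.1 hz]; exact fun h => hx (σ.injective h)
  · intro hz
    exact ⟨⟨{z, σ z}, Finset.card_pair hz.symm⟩,
      Finset.mem_filter.2 ⟨mem_univ _, z, hz, rfl⟩, by simp⟩

lemma fib_card (W : Finset (Fin n)) :
    #(univ.filter (fun S : Finset (FaceIdx n 1) => vs S ⊆ W)) ≤ 2 ^ 2 ^ #W := by
  have h1 : univ.filter (fun S : Finset (FaceIdx n 1) => vs S ⊆ W)
      ⊆ (univ.filter (fun e : FaceIdx n 1 => e.1 ⊆ W)).powerset := by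
    intro S hS
    rw [Finset.mem_powerset]
    intro e he
    refine Finset.mem_filter.2 ⟨mem_univ _, ?_⟩
    exact (Finset.subset_biUnion_of_mem (fun e : FaceIdx n 1 => e.1) he).trans
      (Finset.mem_filter.1 hS).2
  refine (Finset.card_le_card h1).trans ?_
  rw [Finset.card_powerset]
  refine Nat.pow_le_pow_right (by norm_num) ?_
  rw [← Finset.card_powerset]
  refine Finset.card_le_card_of_injOn (fun e => e.1) ?_ ?_
  · intro e he
    have := (Finset.mem_filter.1 he).2
    simpa using this
  · intro a _ b _ hab; exact Subtype.ext hab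

lemma delta_bound (m : ℕ) {c : ℝ} (hc : 0 ≤ c) (hn : 1 ≤ n) (hcn : c ≤ n) :
    ∑ S ∈ fam n m, ∑ T ∈ fam n m with (S ≠ T ∧ ¬ Disjoint S T), (c / n) ^ #(S ∪ T)
      ≤ (c / n) * (((2 ^ 2 ^ (2 * (m + 3))) ^ 2 : ℕ) * ∑ v ∈ range (2 * (m + 3) + 1), c ^ v) := by
  have hn1 : (1 : ℝ) ≤ n := by exact_mod_cast hn
  set p := c / n with hp
  have h0 : 0 ≤ p := by positivity
  have h1 : p ≤ 1 := div_le_one_of_le₀ hcn (by linarith)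
  set K := 2 * (m + 3) with hK
  have hvs : ∀ S ∈ fam n m, ∃ σ, IsC σ ∧ #σ.support ≤ m + 3 ∧ edg σ = S := by
    intro S hS
    obtain ⟨i, hi, hS⟩ := Finset.mem_biUnion.1 hS
    obtain ⟨σ, h1, h2, h3⟩ := mem_cyc (by omega) hS
    have := Finset.mem_range.1 hi
    exact ⟨σ, h1, by omega, h3⟩
  have s1 : ∑ S ∈ fam n m, ∑ T ∈ fam n m with (S ≠ T ∧ ¬ Disjoint S T), p ^ #(S ∪ T)
      ≤ ∑ S ∈ fam n m, ∑ T ∈ fam n m, p * p ^ #(vs S ∪ vs T) := by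
    refine Finset.sum_le_sum fun S hS => ?_
    refine le_trans ?_ (Finset.sum_le_sum_of_subset_of_nonneg
      (Finset.filter_subset (fun T => S ≠ T ∧ ¬ Disjoint S T) _)
      (fun _ _ _ => mul_nonneg h0 (pow_nonneg h0 _)))
    refine Finset.sum_le_sum fun T hT => ?_
    obtain ⟨hT2, hne, hd⟩ := Finset.mem_filter.1 hT
    obtain ⟨σ, hσ, -, rfl⟩ := hvs S hS
    obtain ⟨τ, hτ, -, rfl⟩ := hvs T hT2
    rw [vs_edg, vs_edg, ← pow_succ']
    exact pow_le_pow_of_le_one h0 h1 (union_card hσ hτ hne hd)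
  refine s1.trans ?_
  simp only [← Finset.mul_sum]
  refine mul_le_mul_of_nonneg_left ?_ h0
  rw [← Finset.sum_product' (fam n m) (fam n m) (fun S T => p ^ #(vs S ∪ vs T))]
  set Ws : Finset (Finset (Fin n)) := univ.filter (fun W => #W ≤ K) with hWs
  have hmaps : ∀ x ∈ fam n m ×ˢ fam n m, vs x.1 ∪ vs x.2 ∈ Ws := by
    intro x hx
    obtain ⟨hx1, hx2⟩ := Finset.mem_product.1 hx
    refine Finset.mem_filter.2 ⟨mem_univ _, ?_⟩
    obtain ⟨σ, -, h3, h4⟩ := hvs _ hx1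
    obtain ⟨τ, -, h5, h6⟩ := hvs _ hx2
    rw [← h4, ← h6, vs_edg, vs_edg]
    refine (Finset.card_union_le _ _).trans ?_
    omega
  rw [← Finset.sum_fiberwise_of_maps_to hmaps]
  have s2 : ∀ W ∈ Ws, ∑ x ∈ fam n m ×ˢ fam n m with vs x.1 ∪ vs x.2 = W, p ^ #(vs x.1 ∪ vs x.2)
      ≤ ((2 ^ 2 ^ K) ^ 2 : ℕ) * p ^ #W := by
    intro W hW
    rw [Finset.sum_congr rfl (fun x hx => by rw [(Finset.mem_filter.1 hx).2]), Finset.sum_const,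
      nsmul_eq_mul]
    refine mul_le_mul_of_nonneg_right ?_ (pow_nonneg h0 _)
    norm_cast
    set B := univ.filter (fun S : Finset (FaceIdx n 1) => vs S ⊆ W) with hB
    have hsub : (fam n m ×ˢ fam n m).filter (fun x => vs x.1 ∪ vs x.2 = W) ⊆ B ×ˢ B := by
      intro x hx
      have := (Finset.mem_filter.1 hx).2
      refine Finset.mem_product.2 ⟨Finset.mem_filter.2 ⟨mem_univ _, ?_⟩,
        Finset.mem_filter.2 ⟨mem_univ _, ?_⟩⟩
      · rw [← this]; exact Finset.subset_union_left
      · rw [← this]; exact Finset.subset_union_right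
    refine (Finset.card_le_card hsub).trans ?_
    rw [Finset.card_product, ← sq]
    refine Nat.pow_le_pow_left ((fib_card W).trans ?_) 2
    exact Nat.pow_le_pow_right (by norm_num)
      (Nat.pow_le_pow_right (by norm_num) (Finset.mem_filter.1 hW).2)
  refine (Finset.sum_le_sum s2).trans ?_
  rw [← Finset.mul_sum]
  refine mul_le_mul_of_nonneg_left ?_ (Nat.cast_nonneg _)
  have hmaps2 : ∀ W ∈ Ws, #W ∈ range (K + 1) := by
    intro W hW
    have := (Finset.mem_filter.1 hW).2
    exact Finset.mem_range.2 (by omega)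
  rw [← Finset.sum_fiberwise_of_maps_to hmaps2]
  refine Finset.sum_le_sum fun v _ => ?_
  rw [Finset.sum_congr rfl (fun x hx => by rw [(Finset.mem_filter.1 hx).2]), Finset.sum_const,
      nsmul_eq_mul]
  have hcard : #(Ws.filter (fun W => #W = v)) ≤ n ^ v := by
    have : Ws.filter (fun W => #W = v) ⊆ Finset.powersetCard v univ := by
      intro W hW
      exact Finset.mem_powersetCard.2 ⟨Finset.subset_univ _, (Finset.mem_filter.1 hW).2⟩
    refine (Finset.card_le_card this).trans ?_
    rw [Finset.card_powersetCard, Finset.card_univ, Fintype.card_fin]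
    exact Nat.choose_le_pow n v
  calc (#(Ws.filter (fun W => #W = v)) : ℝ) * p ^ v ≤ (n : ℝ) ^ v * p ^ v := by
        refine mul_le_mul_of_nonneg_right ?_ (pow_nonneg h0 _)
        exact_mod_cast hcard
    _ = c ^ v := by
        rw [← mul_pow, hp, mul_div_cancel₀]
        linarith

lemma acy_upper {c : ℝ} (hc : 0 < c) (m : ℕ) {b : ℝ}
    (hb : Real.exp (- ∑ i ∈ range m, ff c i) < b) :
    ∀ᶠ n : ℕ in atTop, acy n (c / n) < b := by
  set M : ℝ := (((2 ^ 2 ^ (2 * (m + 3))) ^ 2 : ℕ) * ∑ v ∈ range (2 * (m + 3) + 1), c ^ v) with hM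
  have t1 : Tendsto (fun n : ℕ => Real.exp (- (∑ S ∈ fam n m, (c / n) ^ #S) + (c / n) * M))
      atTop (nhds (Real.exp (- (∑ i ∈ range m, ff c i) + 0 * M))) := by
    refine (Real.continuous_exp.tendsto _).comp ?_
    exact (lam_tendsto c m).neg.add ((tendsto_const_div_atTop_nhds_zero_nat c).mul_const M)
  rw [zero_mul, add_zero] at t1
  obtain ⟨N, hN⟩ := exists_nat_ge c
  filter_upwards [t1.eventually (gt_mem_nhds hb), eventually_ge_atTop (max N 1)] with n h1 h2
  refine lt_of_le_of_lt ?_ h1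
  have hn : 1 ≤ n := le_trans (le_max_right _ _) h2
  have hcn : c ≤ n := hN.trans (by exact_mod_cast le_trans (le_max_left _ _) h2)
  have hn1 : (1 : ℝ) ≤ n := by exact_mod_cast hn
  have h0 : 0 ≤ c / n := by positivity
  have hp1 : c / n ≤ 1 := div_le_one_of_le₀ hcn (by linarith)
  refine (acy_le m h0 hp1).trans ((janson h0 hp1 _).trans (Real.exp_le_exp.2 ?_))
  have := delta_bound (n := n) m hc.le hn hcn
  linarith

lemma ff_nonneg {c : ℝ} (hc : 0 ≤ c) (i : ℕ) : 0 ≤ ff c i := by unfold ff; positivity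

lemma ff_hasSum {c : ℝ} (hc : 0 < c) (hc1 : c < 1) :
    HasSum (ff c) (- (Real.log (1 - c)) / 2 - c / 2 - c ^ 2 / 4) := by
  have h := Real.hasSum_pow_div_log_of_abs_lt_one (x := c) (by rw [abs_lt]; constructor <;> linarith)
  have h2 := ((hasSum_nat_add_iff' 2).2 h).div_const 2
  simp only [Finset.sum_range_succ, Finset.sum_range_zero] at h2
  convert! h2 using 1
  · funext i
    unfold ff
    push_cast
    have : ((i : ℝ) + 2 + 1) ≠ 0 := by positivity
    have : ((i : ℝ) + 3) ≠ 0 := by positivity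
    rw [div_div]
    congr 1
    ring
  · norm_num
    ring

lemma ff_tendsto_atTop {c : ℝ} (hc1 : 1 ≤ c) :
    Tendsto (fun m => ∑ i ∈ range m, ff c i) atTop atTop := by
  rw [← not_summable_iff_tendsto_nat_atTop_of_nonneg (ff_nonneg (by linarith))]
  intro hs
  have h2 : Summable (fun i : ℕ => 1 / ((i + 3 : ℕ) : ℝ)) := by
    refine Summable.of_nonneg_of_le (fun i => by positivity) (fun i => ?_) (hs.mul_left 2)
    unfold ff
    have : (1 : ℝ) ≤ c ^ (i + 3) := one_le_pow₀ hc1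
    have h3 : (0 : ℝ) < i + 3 := by positivity
    have e : 2 * (c ^ (i + 3) / (2 * ((i : ℝ) + 3))) = c ^ (i + 3) / (i + 3) := by field_simp
    rw [e]
    push_cast
    gcongr
  exact Real.not_summable_one_div_natCast
    ((summable_nat_add_iff (f := fun i : ℕ => 1 / (i : ℝ)) 3).1 h2)

lemma good_n (c : ℝ) (hc : 0 < c) : ∀ᶠ n : ℕ in atTop, 0 ≤ c / n ∧ c / n ≤ 1 := by
  obtain ⟨N, hN⟩ := exists_nat_ge c
  filter_upwards [eventually_ge_atTop N] with n hn
  have : c ≤ n := hN.trans (by exact_mod_cast hn)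
  exact ⟨by positivity, div_le_one_of_le₀ this (by positivity)⟩

lemma acy_tendsto_one {c : ℝ} (hc1 : 1 ≤ c) :
    Tendsto (fun n : ℕ => acy n (c / n)) atTop (nhds 0) := by
  have hc : 0 < c := by linarith
  rw [tendsto_order]
  constructor
  · intro a ha
    filter_upwards [good_n c hc] with n hn
    exact lt_of_lt_of_le ha (acy_nonneg hn.1 hn.2)
  · intro b hb
    have t : Tendsto (fun m => Real.exp (- ∑ i ∈ range m, ff c i)) atTop (nhds 0) :=
      Real.tendsto_exp_neg_atTop_nhds_zero.comp (ff_tendsto_atTop hc1)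
    obtain ⟨m, hm⟩ := (t.eventually (gt_mem_nhds hb)).exists
    exact acy_upper hc m hm

lemma acy_tendsto_lt {c : ℝ} (hc : 0 < c) (hc1 : c < 1) :
    Tendsto (fun n : ℕ => acy n (c / n)) atTop
      (nhds (Real.sqrt (1 - c) * Real.exp (c / 2 + c ^ 2 / 4))) := by
  have hs := ff_hasSum hc hc1
  set L := - (Real.log (1 - c)) / 2 - c / 2 - c ^ 2 / 4 with hL
  have hval : Real.sqrt (1 - c) * Real.exp (c / 2 + c ^ 2 / 4) = Real.exp (-L) := by
    have h1 : 0 < 1 - c := by linarith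
    have : Real.sqrt (1 - c) = Real.exp (Real.log (1 - c) / 2) := by
      rw [← Real.log_sqrt h1.le, Real.exp_log (Real.sqrt_pos.2 h1)]
    rw [this, ← Real.exp_add, hL]
    congr 1
    ring
  rw [hval, tendsto_order]
  constructor
  · intro a ha
    have t : Tendsto (fun n : ℕ => Real.exp (- (L / (1 - c / n)))) atTop
        (nhds (Real.exp (- (L / (1 - 0))))) := by
      refine (Real.continuous_exp.tendsto _).comp (Tendsto.neg ?_)
      exact tendsto_const_nhds.div
        (tendsto_const_nhds.sub (tendsto_const_div_atTop_nhds_zero_nat c)) (by norm_num)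
    rw [sub_zero, div_one] at t
    filter_upwards [t.eventually (lt_mem_nhds ha), eventually_ge_atTop 1] with n h1 h2
    refine lt_of_lt_of_le h1 (acy_lower hc hc1 (fun m => ?_) h2)
    exact sum_le_hasSum _ (fun i _ => ff_nonneg hc.le i) hs
  · intro b hb
    have t : Tendsto (fun m => Real.exp (- ∑ i ∈ range m, ff c i)) atTop (nhds (Real.exp (-L))) :=
      (Real.continuous_exp.tendsto _).comp hs.tendsto_sum_nat.neg
    obtain ⟨m, hm⟩ := (t.eventually (gt_mem_nhds hb)).exists
    exact acy_upper hc m hm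

end Bounds

/-- **The birth of cycles in `G(n,p)`** (Pittel). Let `p = c/n`. If `c ≥ 1` then
w.h.p. `G(n,p)` contains a cycle; if `c < 1` then the probability that `G(n,p)`
is a forest tends to `√(1−c)·exp(c/2 + c²/4)`. -/
theorem birth_of_cycles (c : ℝ) (hc : 0 < c) :
    (1 ≤ c →
      Tendsto (fun n : ℕ => YMeasure n 1 (c / n) {ω | ¬ (graphOf n ω).IsAcyclic})
        atTop (nhds (1 : ENNReal))) ∧
    (c < 1 →
      Tendsto (fun n : ℕ => YMeasure n 1 (c / n) {ω | (graphOf n ω).IsAcyclic})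
        atTop (nhds (ENNReal.ofReal
          (Real.sqrt (1 - c) * Real.exp (c / 2 + c ^ 2 / 4))))) := by
  constructor
  · intro h1
    have t := ENNReal.tendsto_ofReal ((acy_tendsto_one h1).const_sub 1)
    rw [sub_zero, ENNReal.ofReal_one] at t
    refine t.congr' ?_
    filter_upwards [good_n c hc] with n hn
    exact (measure_not_acy hn.1 hn.2).symm
  · intro h1
    refine (ENNReal.tendsto_ofReal (acy_tendsto_lt hc h1)).congr' ?_
    filter_upwards [good_n c hc] with n hn
    exact (measure_acy hn.1 hn.2).symm
end
end
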